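/- arXiv:1811.06190 — 7 statements merged into one kernel-verified Lean document; each statement's English description precedes it below -/
import Mathlib

section
/- Let (M,g) be a standard P_l(𝓞)-module, and for 1 ≤ j ≤ l let F_j ⊆ K_j(M) be a finite set whose image under the natural projection K_j(M) → Q_j(M) is a free 𝓞-basis of Q_j(M); let U_j be the 𝓞-submodule of M generated by F_j. Then for all 1 ≤ i ≤ j ≤ l: K_j(M) is the internal direct sum U_j ⊕ L_j(M) (that is, U_j + L_j(M) = K_j(M) and U_j ∩ L_j(M) = 0), and I_{i,j}(M) is the internal direct sum g^{j-i}(U_j) ⊕ I_{i,j+1}(M). -/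
open NumberField

/-- For an `R`-module endomorphism `g`, `kerPow g i = K_i = ker (g^i)`. -/
def kerPow {R M : Type*} [CommRing R] [AddCommGroup M] [Module R M]
    (g : M →ₗ[R] M) (i : ℕ) : Submodule R M :=
  LinearMap.ker (g ^ i)

/-- `Isub g i j = I_{i,j} = g^{j-i}(K_j) + K_{i-1}`. -/
def Isub {R M : Type*} [CommRing R] [AddCommGroup M] [Module R M]
    (g : M →ₗ[R] M) (i j : ℕ) : Submodule R M :=
  (kerPow g j).map (g ^ (j - i)) ⊔ kerPow g (i - 1)

/-- `Lsub g i = L_i = g(K_{i+1}) + K_{i-1}`. -/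
def Lsub {R M : Type*} [CommRing R] [AddCommGroup M] [Module R M]
    (g : M →ₗ[R] M) (i : ℕ) : Submodule R M :=
  (kerPow g (i + 1)).map g ⊔ kerPow g (i - 1)

/-- `Qquot g i = Q_i = K_i / L_i` as an `R`-module. -/
abbrev Qquot {R M : Type*} [CommRing R] [AddCommGroup M] [Module R M]
    (g : M →ₗ[R] M) (i : ℕ) :=
  ↥(kerPow g i) ⧸ (Lsub g i).comap (kerPow g i).subtype

theorem aux_part_one {R M : Type*} [CommRing R] [AddCommGroup M] [Module R M]
    (N L : Submodule R M) (hL : L ≤ N) (r : ℕ) (F : Fin r → M) (hF : ∀ k, F k ∈ N)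
    (hli : LinearIndependent R (fun k : Fin r =>
        (Submodule.Quotient.mk (⟨F k, hF k⟩ : ↥N) : ↥N ⧸ L.comap N.subtype)))
    (hsp : Submodule.span R (Set.range (fun k : Fin r =>
        (Submodule.Quotient.mk (⟨F k, hF k⟩ : ↥N) : ↥N ⧸ L.comap N.subtype))) = ⊤) :
    Submodule.span R (Set.range F) ⊔ L = N ∧ Submodule.span R (Set.range F) ⊓ L = ⊥ := by
  have key : ∀ (c : Fin r → R) (x : N), ((x : M) - ∑ k, c k • F k ∈ L) ↔
      ∑ k, c k • (Submodule.Quotient.mk (⟨F k, hF k⟩ : ↥N) : ↥N ⧸ L.comap N.subtype) =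
        Submodule.Quotient.mk x := by
    intro c x
    have h : ∑ k, c k • (Submodule.Quotient.mk (⟨F k, hF k⟩ : ↥N) : ↥N ⧸ L.comap N.subtype) =
        Submodule.Quotient.mk (∑ k, c k • (⟨F k, hF k⟩ : ↥N)) := by
      change _ = (L.comap N.subtype).mkQ _
      rw [map_sum]
      rfl
    rw [h, eq_comm, Submodule.Quotient.eq, Submodule.mem_comap, map_sub, map_sum]
    simp
  constructor
  · apply le_antisymm
    · refine sup_le (Submodule.span_le.2 ?_) hL
      rintro _ ⟨k, rfl⟩
      exact hF k
    · intro x hx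
      have h : (Submodule.Quotient.mk (⟨x, hx⟩ : N) : ↥N ⧸ L.comap N.subtype) ∈
        Submodule.span R (Set.range (fun k : Fin r =>
        (Submodule.Quotient.mk (⟨F k, hF k⟩ : ↥N) : ↥N ⧸ L.comap N.subtype))) := by
        rw [hsp]; trivial
      obtain ⟨c, hc⟩ := (Submodule.mem_span_range_iff_exists_fun R).1 h
      have := (key c ⟨x, hx⟩).2 hc
      exact Submodule.mem_sup.2 ⟨∑ k, c k • F k,
        (Submodule.mem_span_range_iff_exists_fun R).2 ⟨c, rfl⟩, _, this, by simp⟩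
  · rw [eq_bot_iff]
    rintro x ⟨hx, hxL⟩
    obtain ⟨c, rfl⟩ := (Submodule.mem_span_range_iff_exists_fun R).1 hx
    have h := (key c 0).1 (by simpa using L.neg_mem hxL)
    have h0 := Fintype.linearIndependent_iff.1 hli c (by simpa using h)
    simp [h0]

theorem aux_part_two {R M : Type*} [CommRing R] [AddCommGroup M] [Module R M]
    (g : M →ₗ[R] M) (U : Submodule R M) (i d : ℕ)
    (h1 : U ⊔ Lsub g (i + 1 + d) = kerPow g (i + 1 + d))
    (h2 : U ⊓ Lsub g (i + 1 + d) = ⊥) :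
    U.map (g ^ d) ⊔ Isub g (i + 1) (i + 1 + d + 1) = Isub g (i + 1) (i + 1 + d) ∧
      U.map (g ^ d) ⊓ Isub g (i + 1) (i + 1 + d + 1) = ⊥ := by
  have e1 : i + 1 + d + 1 - (i + 1) = d + 1 := by omega
  have e2 : i + 1 + d - (i + 1) = d := by omega
  have e3 : i + 1 + d - 1 = i + d := by omega
  have mk : ∀ n x, x ∈ kerPow g n ↔ (g ^ n) x = 0 := fun n x => LinearMap.mem_ker
  have pw : ∀ a b x, (g ^ (a + b)) x = (g ^ a) ((g ^ b) x) := fun a b x => by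
    rw [pow_add]; rfl
  have pws : ∀ a x, (g ^ (a + 1)) x = (g ^ a) (g x) := fun a x => by
    rw [pow_succ]; rfl
  unfold Isub
  unfold Lsub at h1 h2
  rw [e1, e2]
  rw [e3] at h1 h2
  simp only [Nat.add_sub_cancel]
  constructor
  · apply le_antisymm
    · refine sup_le ((Submodule.map_mono (le_sup_left.trans h1.le)).trans le_sup_left)
        (sup_le ?_ le_sup_right)
      refine le_trans ?_ le_sup_left
      rintro _ ⟨x, hx, rfl⟩
      refine ⟨g x, ?_, (pws d x).symm⟩
      rw [SetLike.mem_coe, mk] at hx ⊢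
      rw [← pws]; exact hx
    · refine sup_le ?_ (le_sup_right.trans le_sup_right)
      rw [← h1, Submodule.map_sup, Submodule.map_sup]
      refine sup_le le_sup_left (le_trans (sup_le_sup ?_ ?_) le_sup_right)
      · rintro _ ⟨_, ⟨x, hx, rfl⟩, rfl⟩
        exact ⟨x, hx, pws d x⟩
      · rintro _ ⟨x, hx, rfl⟩
        rw [SetLike.mem_coe, mk] at hx
        rw [mk, ← pw]; exact hx
  · rw [eq_bot_iff]
    rintro _ ⟨⟨u, hu, rfl⟩, hI⟩
    obtain ⟨_, ⟨x, hx, rfl⟩, y, hy, hxy⟩ := Submodule.mem_sup.1 hI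
    have hk : u - g x ∈ kerPow g (i + d) := by
      rw [mk, pw, map_sub, ← pws, ← hxy, add_sub_cancel_left]
      exact (mk _ _).1 hy
    have : u ∈ (⊥ : Submodule R M) := by
      rw [← h2]
      exact ⟨hu, Submodule.mem_sup.2 ⟨g x, ⟨x, hx, rfl⟩, _, hk, by abel⟩⟩
    rw [Submodule.mem_bot] at this
    simp [this]

theorem aux_L_le {R M : Type*} [CommRing R] [AddCommGroup M] [Module R M]
    (g : M →ₗ[R] M) (j : ℕ) : Lsub g j ≤ kerPow g j := by
  refine sup_le ?_ ?_
  · rintro _ ⟨x, hx, rfl⟩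
    have hx' : (g ^ (j + 1)) x = 0 := hx
    rw [pow_succ] at hx'
    exact hx'
  · intro x hx
    have hx' : (g ^ (j - 1)) x = 0 := hx
    change (g ^ j) x = 0
    exact Module.End.pow_map_zero_of_le (Nat.sub_le j 1) hx'

/-- Let `(M,g)` be a standard `P_l(𝓞)`-module, `F_j ⊆ K_j` a finite set
whose image in `Q_j` is a free `𝓞`-basis, and `U_j` the `𝓞`-span of `F_j`. Then for
`1 ≤ i ≤ j ≤ l`: `K_j = U_j ⊕ L_j` and `I_{i,j} = g^{j-i}(U_j) ⊕ I_{i,j+1}` internally. -/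
theorem standard_internal_direct_sums
    {K : Type*} [Field K] [NumberField K]
    {M : Type*} [AddCommGroup M] [Module (𝓞 K) M]
    [Module.Free ℤ M] [Module.Finite ℤ M]
    (l : ℕ) (hl : 1 ≤ l) (g : M →ₗ[𝓞 K] M) (hg : g ^ l = 0)
    (hstd : ∀ i, 1 ≤ i → i ≤ l → Module.Free (𝓞 K) (Qquot g i))
    (r : ℕ → ℕ) (F : (j : ℕ) → Fin (r j) → M)
    (hF : ∀ j k, F j k ∈ kerPow g j)
    (hbasis : ∀ j, 1 ≤ j → j ≤ l →
      LinearIndependent (𝓞 K) (fun k : Fin (r j) =>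
        (Submodule.Quotient.mk (⟨F j k, hF j k⟩ : ↥(kerPow g j)) : Qquot g j)) ∧
      Submodule.span (𝓞 K) (Set.range (fun k : Fin (r j) =>
        (Submodule.Quotient.mk (⟨F j k, hF j k⟩ : ↥(kerPow g j)) : Qquot g j))) = ⊤)
    (U : ℕ → Submodule (𝓞 K) M)
    (hU : ∀ j, U j = Submodule.span (𝓞 K) (Set.range (F j)))
    (i j : ℕ) (h1i : 1 ≤ i) (hij : i ≤ j) (hjl : j ≤ l) :
    (U j ⊔ Lsub g j = kerPow g j ∧ U j ⊓ Lsub g j = ⊥) ∧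
    ((U j).map (g ^ (j - i)) ⊔ Isub g i (j + 1) = Isub g i j ∧
      (U j).map (g ^ (j - i)) ⊓ Isub g i (j + 1) = ⊥) := by
  have hj := hbasis j (h1i.trans hij) hjl
  have A := aux_part_one (kerPow g j) (Lsub g j) (aux_L_le g j) (r j) (F j) (hF j) hj.1 hj.2
  rw [← hU j] at A
  refine ⟨A, ?_⟩
  obtain ⟨i, rfl⟩ : ∃ i', i = i' + 1 := ⟨i - 1, by omega⟩
  obtain ⟨d, rfl⟩ := Nat.exists_eq_add_of_le hij
  have B := aux_part_two g (U (i + 1 + d)) i d A.1 A.2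
  rw [Nat.add_sub_cancel_left]
  exact B
end

section
/- Let (M,g) be a standard P_l(𝓞)-module, and for 1 ≤ j ≤ l let F_j ⊆ K_j(M) be a finite set whose image under the projection K_j(M) → Q_j(M) is a free 𝓞-basis of Q_j(M); let U_j be the 𝓞-submodule generated by F_j. Then for 0 ≤ k ≤ j−1 the restriction of g^k to U_j is injective, and g^k(U_j) is isomorphic to Q_j(M) as an 𝓞-module; moreover the submodules U_j, g(U_j), …, g^{j−1}(U_j) are independent, so that W_j := U_j + g(U_j) + ⋯ + g^{j−1}(U_j) is the internal direct sum U_j ⊕ g(U_j) ⊕ ⋯ ⊕ g^{j−1}(U_j), and W_j equals the smallest g-invariant 𝓞-submodule of M containing U_j. -/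
open NumberField

/-- For a standard `P_l(𝓞)`-module `(M,g)` with `U_j` spanned by lifts of
a free basis of `Q_j`: for `0 ≤ k ≤ j-1`, `g^k` is injective on `U_j` and
`g^k(U_j) ≅ Q_j`; the submodules `U_j, g(U_j), …, g^{j-1}(U_j)` are independent, and their
sum `W_j` is the smallest `g`-invariant `𝓞`-submodule of `M` containing `U_j`. -/
theorem standard_Wj_structure
    {K : Type*} [Field K] [NumberField K]
    {M : Type*} [AddCommGroup M] [Module (𝓞 K) M]
    [Module.Free ℤ M] [Module.Finite ℤ M]
    (l : ℕ) (hl : 1 ≤ l) (g : M →ₗ[𝓞 K] M) (hg : g ^ l = 0)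
    (hstd : ∀ i, 1 ≤ i → i ≤ l → Module.Free (𝓞 K) (Qquot g i))
    (r : ℕ → ℕ) (F : (j : ℕ) → Fin (r j) → M)
    (hF : ∀ j k, F j k ∈ kerPow g j)
    (hbasis : ∀ j, 1 ≤ j → j ≤ l →
      LinearIndependent (𝓞 K) (fun k : Fin (r j) =>
        (Submodule.Quotient.mk (⟨F j k, hF j k⟩ : ↥(kerPow g j)) : Qquot g j)) ∧
      Submodule.span (𝓞 K) (Set.range (fun k : Fin (r j) =>
        (Submodule.Quotient.mk (⟨F j k, hF j k⟩ : ↥(kerPow g j)) : Qquot g j))) = ⊤)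
    (U : ℕ → Submodule (𝓞 K) M)
    (hU : ∀ j, U j = Submodule.span (𝓞 K) (Set.range (F j)))
    (j : ℕ) (h1j : 1 ≤ j) (hjl : j ≤ l)
    (W : Submodule (𝓞 K) M) (hW : W = ⨆ k : Fin j, (U j).map (g ^ (k : ℕ))) :
    (∀ k < j, ∀ x ∈ U j, (g ^ k) x = 0 → x = 0) ∧
    (∀ k < j, Nonempty (↥((U j).map (g ^ k)) ≃ₗ[𝓞 K] Qquot g j)) ∧
    iSupIndep (fun k : Fin j => (U j).map (g ^ (k : ℕ))) ∧
    ((W.map g ≤ W) ∧ U j ≤ W ∧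
      ∀ W' : Submodule (𝓞 K) M, W'.map g ≤ W' → U j ≤ W' → W ≤ W') := by
  have hUK : U j ≤ kerPow g j := by
    rw [hU, Submodule.span_le]
    rintro _ ⟨k, rfl⟩
    exact hF j k
  obtain ⟨hli, hsp⟩ := hbasis j h1j hjl
  have hkill : ∀ x ∈ U j, ∀ m, j ≤ m → (g ^ m) x = 0 := by
    intro x hx m hm
    have h0 : (g ^ j) x = 0 := hUK hx
    obtain ⟨d, rfl⟩ := Nat.exists_eq_add_of_le hm
    rw [add_comm, pow_add, Module.End.mul_apply, h0, map_zero]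
  let φ : U j →ₗ[𝓞 K] Qquot g j :=
    ((Lsub g j).comap (kerPow g j).subtype).mkQ ∘ₗ Submodule.inclusion hUK
  have hφinj : ∀ x : U j, φ x = 0 → x = 0 := by
    rintro ⟨x, hx⟩ h
    have hx' := hx
    rw [hU, Submodule.mem_span_range_iff_exists_fun] at hx'
    obtain ⟨c, rfl⟩ := hx'
    have hc : ∑ k, c k • (Submodule.Quotient.mk (⟨F j k, hF j k⟩ : ↥(kerPow g j)) : Qquot g j)
        = 0 := by
      rw [← h]
      have : Submodule.inclusion hUK ⟨_, hx⟩
          = ∑ k, c k • (⟨F j k, hF j k⟩ : ↥(kerPow g j)) := by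
        ext
        simp
      simp only [φ, LinearMap.comp_apply]
      rw [this, map_sum]
      rfl
    have := Fintype.linearIndependent_iff.1 hli c hc
    ext
    simp [this]
  have hφsurj : Function.Surjective φ := by
    rw [← LinearMap.range_eq_top, eq_top_iff, ← hsp, Submodule.span_le]
    rintro _ ⟨k, rfl⟩
    exact ⟨⟨F j k, by rw [hU]; exact Submodule.subset_span ⟨k, rfl⟩⟩, rfl⟩
  have hinj : ∀ k < j, ∀ x ∈ U j, (g ^ k) x = 0 → x = 0 := by
    intro k hk x hx h
    have h2 : (g ^ (j - 1)) x = 0 := by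
      obtain ⟨d, hd⟩ := Nat.exists_eq_add_of_le (show k ≤ j - 1 by omega)
      rw [hd, add_comm, pow_add, Module.End.mul_apply, h, map_zero]
    have h3 : φ ⟨x, hx⟩ = 0 := by
      refine (Submodule.Quotient.mk_eq_zero _).2 ?_
      exact Submodule.mem_sup_right h2
    exact congrArg Subtype.val (hφinj _ h3)
  refine ⟨hinj, ?_, ?_, ?_, ?_, ?_⟩
  · intro k hk
    have hi : Function.Injective ((g ^ k).domRestrict (U j)) := by
      rw [injective_iff_map_eq_zero]
      rintro ⟨x, hx⟩ h
      ext
      exact hinj k hk x hx h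
    have e1 := LinearEquiv.ofInjective _ hi
    have e2 := LinearEquiv.ofBijective φ ⟨(injective_iff_map_eq_zero φ).2 hφinj, hφsurj⟩
    have e3 := LinearEquiv.ofEq _ _ (LinearMap.range_domRestrict (U j) (g ^ k))
    exact ⟨(e1.trans e3).symm.trans e2⟩
  · classical
    rw [iSupIndep_iff_finsetSum_eq_zero_imp_eq_zero]
    intro s v hv hs
    have key : ∀ n : ℕ, ∀ i ∈ s, (i : ℕ) = n → v i = 0 := by
      intro n
      induction n using Nat.strong_induction_on with
      | _ n ih =>
        intro i hi hin
        have happ := congrArg (g ^ (j - 1 - i)) hs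
        rw [map_sum, map_zero, Finset.sum_eq_single_of_mem i hi] at happ
        · obtain ⟨u, hu, huv⟩ := hv i hi
          rw [← huv, ← Module.End.mul_apply, ← pow_add] at happ
          have := hinj _ (by omega) u hu happ
          rw [← huv, this, map_zero]
        · intro m hm hmi
          have hne : (m : ℕ) ≠ i := fun h => hmi (Fin.ext h)
          by_cases hlt : (m : ℕ) < i
          · rw [ih m (by omega) m hm rfl, map_zero]
          · obtain ⟨u, hu, huv⟩ := hv m hm
            rw [← huv, ← Module.End.mul_apply, ← pow_add]
            exact hkill u hu _ (by omega)
    exact fun i hi => key i i hi rfl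
  · rw [hW, Submodule.map_iSup]
    refine iSup_le fun k => ?_
    by_cases hk : (k : ℕ) + 1 < j
    · refine le_trans ?_ (le_iSup _ (⟨k + 1, hk⟩ : Fin j))
      rw [pow_succ', Module.End.mul_eq_comp, Submodule.map_comp]
    · rintro _ ⟨_, ⟨x, hx, rfl⟩, rfl⟩
      have := hkill x hx (k + 1) (by omega)
      rw [pow_succ', Module.End.mul_apply] at this
      rw [this]
      exact zero_mem _
  · rw [hW]
    refine le_trans ?_ (le_iSup _ (⟨0, h1j⟩ : Fin j))
    simp [Module.End.one_eq_id]
  · intro W' hW' hUW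
    rw [hW]
    refine iSup_le fun k => ?_
    obtain ⟨k, hk⟩ := k
    simp only
    clear hk
    induction k with
    | zero => simpa [Module.End.one_eq_id] using hUW
    | succ n ih =>
      rw [pow_succ', Module.End.mul_eq_comp, Submodule.map_comp]
      exact (Submodule.map_mono ih).trans hW'
end

section
/- Let (M,g) be a standard P_l(𝓞)-module of type (r_1,…,r_l), let F_j ⊆ K_j(M) be a finite set whose image in Q_j(M) is a free 𝓞-basis, let U_j be the 𝓞-submodule generated by F_j, and let W_j = U_j + g(U_j) + ⋯ + g^{j−1}(U_j). Then there is an 𝓞-linear isomorphism ψ : W_j → ((𝓞[y]/(y^j))^{r_j}) satisfying ψ(g(w)) = y·ψ(w) for all w ∈ W_j, where 𝓞[y]/(y^j) is the quotient of the polynomial ring 𝓞[y] by the ideal generated by y^j and y acts by multiplication. In other words, W_j is isomorphic to the free module P_j(𝓞)^{r_j} as a module over the truncated polynomial ring P_j(𝓞) = 𝓞[y]/(y^j). -/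
open NumberField

theorem aux_equiv {R A B M : Type*} [CommRing R] [AddCommGroup A] [AddCommGroup B]
    [AddCommGroup M] [Module R A] [Module R B] [Module R M]
    (φ : A →ₗ[R] M) (π : A →ₗ[R] B) (hπ : Function.Surjective π)
    (hk : LinearMap.ker φ = LinearMap.ker π) (W : Submodule R M) (hW : LinearMap.range φ = W) :
    ∃ ψ : W ≃ₗ[R] B, ∀ a (h : φ a ∈ W), ψ ⟨φ a, h⟩ = π a := by
  subst hW
  refine ⟨φ.quotKerEquivRange.symm.trans ((Submodule.quotEquivOfEq _ _ hk).trans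
    (π.quotKerEquivOfSurjective hπ)), fun a h => ?_⟩
  have : (⟨φ a, h⟩ : LinearMap.range φ) = φ.quotKerEquivRange (Submodule.Quotient.mk a) := rfl
  rw [this]
  simp only [LinearEquiv.trans_apply, LinearEquiv.symm_apply_apply]
  rfl

theorem aux_main {R M : Type*} [CommRing R] [AddCommGroup M] [Module R M]
    (g : M →ₗ[R] M) (j r : ℕ) (h1j : 1 ≤ j) (F : Fin r → M)
    (hF : ∀ k, (g ^ j) (F k) = 0)
    (hind : ∀ c : Fin r → R, (g ^ (j - 1)) (∑ k, c k • F k) = 0 → ∀ k, c k = 0)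
    (W : Submodule R M)
    (hW : W = ⨆ k : Fin j, (Submodule.span R (Set.range F)).map (g ^ (k : ℕ))) :
    ∃ hWg : ∀ x ∈ W, g x ∈ W,
      ∃ ψ : ↥W ≃ₗ[R]
          (Fin r → (Polynomial R ⧸ Ideal.span {(Polynomial.X : Polynomial R) ^ j})),
        ∀ w : ↥W,
          ψ ⟨g (w : M), hWg (w : M) w.2⟩ =
            (Ideal.Quotient.mk (Ideal.span {(Polynomial.X : Polynomial R) ^ j})
              Polynomial.X) • ψ w := by
  have hmem : ∀ i k, (g ^ i) (F k) ∈ W := by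
    intro i k
    by_cases hi : i < j
    · rw [hW]
      exact Submodule.mem_iSup_of_mem (⟨i, hi⟩ : Fin j)
        (Submodule.mem_map_of_mem (Submodule.subset_span ⟨k, rfl⟩))
    · obtain ⟨d, rfl⟩ := Nat.exists_eq_add_of_le (not_lt.mp hi)
      rw [add_comm, pow_add, Module.End.mul_apply, hF, map_zero]
      exact W.zero_mem
  have hWg : ∀ x ∈ W, g x ∈ W := by
    have : W ≤ W.comap g := by
      conv_lhs => rw [hW]
      refine iSup_le fun i => ?_
      rw [Submodule.map_le_iff_le_comap, Submodule.span_le]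
      rintro _ ⟨k, rfl⟩
      have := hmem (i + 1) k
      rw [pow_succ', Module.End.mul_apply] at this
      exact this
    exact this
  let φ : (Fin r → Polynomial R) →ₗ[R] M :=
    ∑ k, (LinearMap.applyₗ (F k)) ∘ₗ (Polynomial.aeval g).toLinearMap ∘ₗ LinearMap.proj k
  have hφ : ∀ p, φ p = ∑ k, (Polynomial.aeval g (p k)) (F k) := by
    intro p
    simp [φ]
  let π : (Fin r → Polynomial R) →ₗ[R]
      (Fin r → (Polynomial R ⧸ Ideal.span {(Polynomial.X : Polynomial R) ^ j})) :=
    LinearMap.pi fun k => (Ideal.Quotient.mkₐ R _).toLinearMap ∘ₗ LinearMap.proj k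
  have hπ : ∀ p k, π p k = Ideal.Quotient.mk _ (p k) := fun p k => rfl
  have hπs : Function.Surjective π := by
    intro b
    choose p hp using fun k => Ideal.Quotient.mk_surjective (b k)
    exact ⟨p, funext hp⟩
  have hπ0 : ∀ p, π p = 0 ↔ ∀ k, Polynomial.X ^ j ∣ p k := by
    intro p
    rw [funext_iff]
    refine forall_congr' fun k => ?_
    rw [hπ, Pi.zero_apply, Ideal.Quotient.eq_zero_iff_mem, Ideal.mem_span_singleton]
  have hkill : ∀ (p : Polynomial R) k, Polynomial.X ^ j ∣ p → (Polynomial.aeval g p) (F k) = 0 := by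
    rintro _ k ⟨q, rfl⟩
    rw [mul_comm, map_mul, Module.End.mul_apply, map_pow, Polynomial.aeval_X, hF, map_zero]
  have hφX : ∀ n p, φ (fun k => Polynomial.X ^ n * p k) = (g ^ n) (φ p) := by
    intro n p
    simp only [hφ, map_sum, map_mul, map_pow, Polynomial.aeval_X, Module.End.mul_apply]
  have hker : LinearMap.ker φ = LinearMap.ker π := by
    ext p
    rw [LinearMap.mem_ker, LinearMap.mem_ker, hπ0]
    constructor
    · intro hp
      have : ∀ n, n ≤ j → ∀ k, Polynomial.X ^ n ∣ p k := by
        intro n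
        induction n with
        | zero => intro _ k; simp
        | succ n ih =>
          intro hn
          choose q hq using ih (by omega)
          have hpq : p = fun k => Polynomial.X ^ n * q k := funext hq
          have h0 : φ (fun k => Polynomial.X ^ (j - 1) * q k) = 0 := by
            have h2 : (fun k => Polynomial.X ^ (j - 1) * q k)
                = fun k => Polynomial.X ^ (j - 1 - n) * p k := by
              funext k
              rw [hq k, ← mul_assoc, ← pow_add]
              congr 2
              omega
            rw [h2, hφX, hp, map_zero]
          have h3 : (g ^ (j - 1)) (∑ k, (q k).coeff 0 • F k) = 0 := by
            rw [← h0, hφ, map_sum]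
            refine Finset.sum_congr rfl fun k _ => ?_
            conv_rhs => rw [← Polynomial.divX_mul_X_add (q k)]
            have h4 : Polynomial.X ^ (j - 1) * ((q k).divX * Polynomial.X + Polynomial.C ((q k).coeff 0))
                = Polynomial.X ^ j * (q k).divX
                  + Polynomial.X ^ (j - 1) * Polynomial.C ((q k).coeff 0) := by
              obtain ⟨m, rfl⟩ := Nat.exists_eq_add_of_le h1j
              simp only [Nat.add_sub_cancel_left]
              ring
            rw [h4, map_add, LinearMap.add_apply, hkill _ k (Dvd.intro _ rfl), zero_add]
            simp [Module.algebraMap_end_apply]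
          intro k
          have h5 := Polynomial.X_dvd_iff.mpr (hind _ h3 k)
          rw [hq k, pow_succ]
          exact mul_dvd_mul_left _ h5
      exact this j le_rfl
    · intro hp
      rw [hφ]
      exact Finset.sum_eq_zero fun k _ => hkill _ k (hp k)
  have hrange : LinearMap.range φ = W := by
    apply le_antisymm
    · rintro _ ⟨p, rfl⟩
      rw [hφ]
      refine W.sum_mem fun k _ => ?_
      rw [Polynomial.aeval_eq_sum_range, LinearMap.sum_apply]
      exact W.sum_mem fun i _ => W.smul_mem _ (hmem i k)
    · rw [hW]
      refine iSup_le fun i => ?_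
      rw [Submodule.map_le_iff_le_comap, Submodule.span_le]
      rintro _ ⟨k, rfl⟩
      refine ⟨Pi.single k (Polynomial.X ^ (i : ℕ)), ?_⟩
      rw [hφ, Finset.sum_eq_single k]
      · simp
      · intro b _ hb
        simp [Pi.single_eq_of_ne hb]
      · simp
  obtain ⟨ψ, hψ⟩ := aux_equiv φ π hπs hker W hrange
  refine ⟨hWg, ψ, ?_⟩
  rintro ⟨w, hw⟩
  obtain ⟨p, rfl⟩ : w ∈ LinearMap.range φ := hrange ▸ hw
  have h1 := hφX 1 p
  simp only [pow_one] at h1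
  have h2 : ∀ h, ψ ⟨g (φ p), h⟩ = π (fun k => Polynomial.X * p k) := by
    rw [← h1]
    exact hψ _
  rw [h2, hψ]
  funext k
  simp [hπ]

/-- For a standard `P_l(𝓞)`-module `(M,g)` of type `(r_1,…,r_l)`, the
submodule `W_j = U_j + g(U_j) + ⋯ + g^{j-1}(U_j)` is isomorphic to `(𝓞[y]/(y^j))^{r_j}`
via an `𝓞`-linear isomorphism `ψ` intertwining `g` with multiplication by `y`. -/
theorem Wj_iso_free_truncated_polynomial_module
    {K : Type*} [Field K] [NumberField K]
    {M : Type*} [AddCommGroup M] [Module (𝓞 K) M]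
    [Module.Free ℤ M] [Module.Finite ℤ M]
    (l : ℕ) (hl : 1 ≤ l) (g : M →ₗ[𝓞 K] M) (hg : g ^ l = 0)
    (hstd : ∀ i, 1 ≤ i → i ≤ l → Module.Free (𝓞 K) (Qquot g i))
    (r : ℕ → ℕ) (F : (j : ℕ) → Fin (r j) → M)
    (hF : ∀ j k, F j k ∈ kerPow g j)
    (hbasis : ∀ j, 1 ≤ j → j ≤ l →
      LinearIndependent (𝓞 K) (fun k : Fin (r j) =>
        (Submodule.Quotient.mk (⟨F j k, hF j k⟩ : ↥(kerPow g j)) : Qquot g j)) ∧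
      Submodule.span (𝓞 K) (Set.range (fun k : Fin (r j) =>
        (Submodule.Quotient.mk (⟨F j k, hF j k⟩ : ↥(kerPow g j)) : Qquot g j))) = ⊤)
    (U : ℕ → Submodule (𝓞 K) M)
    (hU : ∀ j, U j = Submodule.span (𝓞 K) (Set.range (F j)))
    (j : ℕ) (h1j : 1 ≤ j) (hjl : j ≤ l)
    (W : Submodule (𝓞 K) M) (hW : W = ⨆ k : Fin j, (U j).map (g ^ (k : ℕ))) :
    ∃ hWg : ∀ x ∈ W, g x ∈ W,
      ∃ ψ : ↥W ≃ₗ[𝓞 K]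
          (Fin (r j) → (Polynomial (𝓞 K) ⧸ Ideal.span {(Polynomial.X : Polynomial (𝓞 K)) ^ j})),
        ∀ w : ↥W,
          ψ ⟨g (w : M), hWg (w : M) w.2⟩ =
            (Ideal.Quotient.mk (Ideal.span {(Polynomial.X : Polynomial (𝓞 K)) ^ j})
              Polynomial.X) • ψ w := by
  rw [hU] at hW
  refine aux_main g j (r j) h1j (F j) (hF j) ?_ W hW
  intro c hc
  refine Fintype.linearIndependent_iff.mp (hbasis j h1j hjl).1 c ?_
  have hx : (∑ k, c k • (Submodule.Quotient.mk (⟨F j k, hF j k⟩ : ↥(kerPow g j)) : Qquot g j))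
      = Submodule.Quotient.mk (∑ k, c k • (⟨F j k, hF j k⟩ : ↥(kerPow g j))) := by
    simp only [← Submodule.mkQ_apply, map_sum, map_smul]
  rw [hx, Submodule.Quotient.mk_eq_zero, Submodule.mem_comap]
  refine Submodule.mem_sup_right ?_
  rw [map_sum]
  exact hc
end

section
/- Let (M,g) be a standard P_l(𝓞)-module, let F_j ⊆ K_j(M) be a finite set whose image in Q_j(M) is a free 𝓞-basis, and let U_j be the 𝓞-submodule generated by F_j, for 1 ≤ j ≤ l. Then M is the internal direct sum of the family of 𝓞-submodules { g^k(U_j) : 1 ≤ j ≤ l, 0 ≤ k ≤ j−1 }: these submodules are independent and their sum is all of M. Consequently, with W_j = U_j ⊕ g(U_j) ⊕ ⋯ ⊕ g^{j−1}(U_j), one has M = W_1 ⊕ ⋯ ⊕ W_l, a direct sum of g-invariant 𝓞-submodules. -/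
open NumberField

section aux
variable {R M : Type*} [CommRing R] [AddCommGroup M] [Module R M]

theorem aux_mem_kerPow (g : M →ₗ[R] M) (i : ℕ) (x : M) :
    x ∈ kerPow g i ↔ (g ^ i) x = 0 := Iff.rfl

theorem aux_pow_add (g : M →ₗ[R] M) (a b : ℕ) (x : M) :
    (g ^ a) ((g ^ b) x) = (g ^ (a + b)) x := by
  rw [pow_add]; rfl

theorem aux_kerPow_mono (g : M →ₗ[R] M) {i j : ℕ} (h : i ≤ j) : kerPow g i ≤ kerPow g j := by
  intro x hx
  rw [aux_mem_kerPow] at *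
  obtain ⟨c, rfl⟩ := Nat.exists_eq_add_of_le' h
  rw [← aux_pow_add, hx, map_zero]

theorem aux_pow_mem (g : M →ₗ[R] M) {i j k : ℕ} (h : j ≤ i + k) {x : M} (hx : x ∈ kerPow g j) :
    (g ^ k) x ∈ kerPow g i := by
  have := aux_kerPow_mono g h hx
  rw [aux_mem_kerPow] at *
  rwa [aux_pow_add]

theorem aux_layer (l : ℕ) (g : M →ₗ[R] M) (U : ℕ → Submodule R M)
    (hUK : ∀ j, U j ≤ kerPow g j)
    (hdis : ∀ j, 1 ≤ j → j ≤ l → ∀ x ∈ U j, x ∈ Lsub g j → x = 0) (n : ℕ) :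
    ∀ (i : ℕ) (w : ℕ → M), i + n ≤ l → (∀ k, w k ∈ U (i + 1 + k)) →
      ∑ k ∈ Finset.range n, (g ^ k) (w k) ∈ kerPow g i → ∀ k < n, w k = 0 := by
  induction n with
  | zero => intro i w _ _ _ k hk; omega
  | succ n ih =>
    intro i w hi hw hs
    have e : ∑ k ∈ Finset.range (n + 1), (g ^ k) (w k)
        = g (∑ k ∈ Finset.range n, (g ^ k) (w (k + 1))) + w 0 := by
      rw [Finset.sum_range_succ', map_sum]
      simp [pow_succ']
    rw [e] at hs
    have hin : ∑ k ∈ Finset.range n, (g ^ k) (w (k + 1)) ∈ kerPow g (i + 1 + 1) := by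
      refine Submodule.sum_mem _ fun k _ => ?_
      exact aux_pow_mem g (by omega) (hUK _ (hw (k + 1)))
    have h0 : w 0 = 0 := by
      refine hdis (i + 1) (by omega) (by omega) _ (hw 0) ?_
      have h1 : w 0 = -(g (∑ k ∈ Finset.range n, (g ^ k) (w (k + 1))))
        + (g (∑ k ∈ Finset.range n, (g ^ k) (w (k + 1))) + w 0) := by abel
      rw [h1]
      exact Submodule.add_mem_sup
        (Submodule.neg_mem _ (Submodule.mem_map_of_mem hin)) hs
    rw [h0, add_zero] at hs
    have hs' : ∑ k ∈ Finset.range n, (g ^ k) (w (k + 1)) ∈ kerPow g (i + 1) := by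
      rw [aux_mem_kerPow] at *
      rw [pow_succ]; exact hs
    have := ih (i + 1) (fun k => w (k + 1)) (by omega)
      (fun k => by have := hw (k + 1); rwa [show i + 1 + (k + 1) = i + 1 + 1 + k by omega] at this) hs'
    intro k hk
    cases k with
    | zero => exact h0
    | succ k => exact this k (by omega)

theorem aux_all (l : ℕ) (g : M →ₗ[R] M) (U : ℕ → Submodule R M)
    (hUK : ∀ j, U j ≤ kerPow g j)
    (hdis : ∀ j, 1 ≤ j → j ≤ l → ∀ x ∈ U j, x ∈ Lsub g j → x = 0)
    (v : ℕ → ℕ → M) (hv : ∀ a k, v a k ∈ U (a + 1 + k)) (m : ℕ) (hm : m ≤ l)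
    (hs : ∑ a ∈ Finset.range m, ∑ k ∈ Finset.range (l - a), (g ^ k) (v a k) = 0) :
    ∀ a < m, ∀ k < l - a, v a k = 0 := by
  induction m with
  | zero => intro a ha; omega
  | succ m ih =>
    rw [Finset.sum_range_succ] at hs
    have hmem : ∑ k ∈ Finset.range (l - m), (g ^ k) (v m k) ∈ kerPow g m := by
      rw [eq_neg_of_add_eq_zero_right hs]
      refine Submodule.neg_mem _ (Submodule.sum_mem _ fun a ha => Submodule.sum_mem _ fun k _ => ?_)
      rw [Finset.mem_range] at ha
      exact aux_pow_mem g (by omega) (hUK _ (hv a k))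
    have hz := aux_layer l g U hUK hdis (l - m) m (v m) (by omega) (hv m) hmem
    rw [Finset.sum_eq_zero (s := Finset.range (l - m)) (fun k hk => by
      rw [hz k (Finset.mem_range.1 hk), map_zero]), add_zero] at hs
    intro a ha k hk
    rcases Nat.lt_succ_iff_lt_or_eq.1 ha with h | h
    · exact ih (by omega) hs a h k hk
    · subst h; exact hz k hk

theorem aux_indep (l : ℕ) (g : M →ₗ[R] M) (U : ℕ → Submodule R M)
    (hUK : ∀ j, U j ≤ kerPow g j)
    (hdis : ∀ j, 1 ≤ j → j ≤ l → ∀ x ∈ U j, x ∈ Lsub g j → x = 0) :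
    iSupIndep (fun p : {p : ℕ × ℕ // 1 ≤ p.1 ∧ p.1 ≤ l ∧ p.2 < p.1} =>
        (U p.1.1).map (g ^ p.1.2)) := by
  classical
  rw [iSupIndep_iff_finsetSum_eq_zero_imp_eq_zero]
  intro s f hf hsum
  have hf' : ∀ p : {p : ℕ × ℕ // 1 ≤ p.1 ∧ p.1 ≤ l ∧ p.2 < p.1}, ∃ u : M, u ∈ U p.1.1 ∧
      (p ∈ s → (g ^ p.1.2) u = f p) ∧ (p ∉ s → u = 0) := by
    intro p
    by_cases hp : p ∈ s
    · obtain ⟨u, hu, hu'⟩ := hf p hp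
      exact ⟨u, hu, fun _ => hu', fun h => absurd hp h⟩
    · exact ⟨0, Submodule.zero_mem _, fun h => absurd h hp, fun _ => rfl⟩
  choose u hu hu1 hu2 using hf'
  let v : ℕ → ℕ → M := fun a k =>
    if h : a + 1 + k ≤ l then u ⟨(a + 1 + k, k), by dsimp only; omega⟩ else 0
  have hv : ∀ a k, v a k ∈ U (a + 1 + k) := by
    intro a k
    by_cases h : a + 1 + k ≤ l
    · simp only [v, dif_pos h]
      exact hu ⟨(a + 1 + k, k), _⟩
    · simp only [v, dif_neg h]
      exact Submodule.zero_mem _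
  have hvp : ∀ p : {p : ℕ × ℕ // 1 ≤ p.1 ∧ p.1 ≤ l ∧ p.2 < p.1},
      v (p.1.1 - 1 - p.1.2) p.1.2 = u p := by
    rintro ⟨⟨j, k⟩, h1, h2, h3⟩
    dsimp only at *
    have e : j - 1 - k + 1 + k = j := by omega
    simp only [v, e, dif_pos h2]
  have hs : ∑ a ∈ Finset.range l, ∑ k ∈ Finset.range (l - a), (g ^ k) (v a k) = 0 := by
    rw [← hsum, Finset.sum_sigma']
    symm
    refine Finset.sum_of_injOn (fun p => ⟨p.1.1 - 1 - p.1.2, p.1.2⟩) ?_ ?_ ?_ ?_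
    · rintro ⟨⟨j, k⟩, h1, h2, h3⟩ _ ⟨⟨j', k'⟩, h1', h2', h3'⟩ _ h
      simp only [Sigma.mk.injEq, heq_eq_eq] at h
      simp only [Subtype.mk.injEq, Prod.mk.injEq]
      try dsimp only at *
      omega
    · rintro ⟨⟨j, k⟩, h1, h2, h3⟩ _
      try dsimp only at *
      simp only [Finset.coe_sigma, Set.mem_sigma_iff, Finset.mem_coe, Finset.mem_range]
      omega
    · rintro ⟨a, k⟩ _ hn
      have : v a k = 0 := by
        by_cases h : a + 1 + k ≤ l
        · simp only [v, dif_pos h]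
          apply hu2
          intro hmem
          refine hn ⟨_, hmem, ?_⟩
          simp only [Sigma.mk.injEq, heq_eq_eq, and_true]
          omega
        · simp only [v, dif_neg h]
      simp [this]
    · intro p hp
      dsimp only
      rw [hvp, hu1 p hp]
  intro p hp
  have h := aux_all l g U hUK hdis v hv l le_rfl hs (p.1.1 - 1 - p.1.2)
    (by have := p.2; omega) p.1.2 (by have := p.2; omega)
  rw [hvp] at h
  rw [← hu1 p hp, h, map_zero]


theorem aux_top (l : ℕ) (g : M →ₗ[R] M) (hg : g ^ l = 0) (U : ℕ → Submodule R M)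
    (hsp : ∀ j, 1 ≤ j → j ≤ l → kerPow g j ≤ U j ⊔ Lsub g j)
    (S : Submodule R M)
    (hS : ∀ j k, 1 ≤ j → j ≤ l → k < j → (U j).map (g ^ k) ≤ S) : S = ⊤ := by
  have key : ∀ i, kerPow g i ≤ S := by
    intro i
    induction i with
    | zero =>
      intro x hx
      rw [aux_mem_kerPow] at hx
      have : x = 0 := by simpa using hx
      rw [this]; exact S.zero_mem
    | succ i ih =>
      have aux : ∀ d k, i + 1 + k + d = l + 1 → ∀ x ∈ kerPow g (i + 1 + k), (g ^ k) x ∈ S := by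
        intro d
        induction d with
        | zero =>
          intro k hk x _
          refine ih (aux_pow_mem g (j := l) (by omega) ?_)
          rw [aux_mem_kerPow, hg]; rfl
        | succ d ihd =>
          intro k hk x hx
          have hx' := hsp (i + 1 + k) (by omega) (by omega) hx
          rw [Submodule.mem_sup] at hx'
          obtain ⟨a, ha, b, hb, rfl⟩ := hx'
          obtain ⟨c, hc, e, he, rfl⟩ := Submodule.mem_sup.1 hb
          obtain ⟨y, hy, rfl⟩ := hc
          rw [map_add, map_add]
          refine S.add_mem ?_ (S.add_mem ?_ ?_)
          · exact hS (i + 1 + k) k (by omega) (by omega) (by omega) (Submodule.mem_map_of_mem ha)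
          · have := ihd (k + 1) (by omega) y hy
            rwa [pow_succ] at this
          · exact ih (aux_pow_mem g (by omega) he)
      intro x hx
      by_cases h : i + 1 ≤ l
      · exact aux (l - i) 0 (by omega) x hx
      · refine ih ?_
        refine aux_kerPow_mono g (i := l) (by omega) ?_
        rw [aux_mem_kerPow, hg]; rfl
  rw [eq_top_iff]
  intro x _
  refine key l ?_
  rw [aux_mem_kerPow, hg]; rfl

theorem aux_dis (g : M →ₗ[R] M) (j r : ℕ) (F : Fin r → M) (hF : ∀ k, F k ∈ kerPow g j)
    (hli : LinearIndependent R (fun k : Fin r =>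
        (Submodule.Quotient.mk (⟨F k, hF k⟩ : ↥(kerPow g j)) : Qquot g j)))
    (x : M) (hx : x ∈ Submodule.span R (Set.range F)) (hx' : x ∈ Lsub g j) : x = 0 := by
  obtain ⟨c, rfl⟩ := (Submodule.mem_span_range_iff_exists_fun R).1 hx
  rw [Fintype.linearIndependent_iff] at hli
  have h := hli c (by
    have : ∑ k, c k • (Submodule.Quotient.mk (⟨F k, hF k⟩ : ↥(kerPow g j)) : Qquot g j)
      = Submodule.mkQ _ (∑ k, c k • (⟨F k, hF k⟩ : ↥(kerPow g j))) := by
      rw [map_sum]; rfl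
    rw [this, Submodule.mkQ_apply, Submodule.Quotient.mk_eq_zero, Submodule.mem_comap]
    simpa using hx')
  simp [h]

theorem aux_spn (g : M →ₗ[R] M) (j r : ℕ) (F : Fin r → M) (hF : ∀ k, F k ∈ kerPow g j)
    (hsp : Submodule.span R (Set.range (fun k : Fin r =>
        (Submodule.Quotient.mk (⟨F k, hF k⟩ : ↥(kerPow g j)) : Qquot g j))) = ⊤) :
    kerPow g j ≤ Submodule.span R (Set.range F) ⊔ Lsub g j := by
  intro x hx
  have h : (Submodule.Quotient.mk (⟨x, hx⟩ : ↥(kerPow g j)) : Qquot g j) ∈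
    Submodule.span R (Set.range (fun k : Fin r =>
        (Submodule.Quotient.mk (⟨F k, hF k⟩ : ↥(kerPow g j)) : Qquot g j))) := by
    rw [hsp]; trivial
  obtain ⟨c, hc⟩ := (Submodule.mem_span_range_iff_exists_fun R).1 h
  have h2 : ∑ k, c k • (Submodule.Quotient.mk (⟨F k, hF k⟩ : ↥(kerPow g j)) : Qquot g j)
      = Submodule.Quotient.mk (∑ k, c k • (⟨F k, hF k⟩ : ↥(kerPow g j))) := by
    change _ = Submodule.mkQ _ _
    rw [map_sum]; rfl
  rw [h2, eq_comm, Submodule.Quotient.eq, Submodule.mem_comap] at hc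
  have hc' : x - ∑ k, c k • F k ∈ Lsub g j := by simpa using hc
  rw [← add_sub_cancel (∑ k, c k • F k) x]
  exact Submodule.add_mem_sup
    ((Submodule.mem_span_range_iff_exists_fun R).2 ⟨c, rfl⟩) hc'

end aux

/-- A standard `P_l(𝓞)`-module `(M,g)` is the internal direct sum of the
family `{ g^k(U_j) : 1 ≤ j ≤ l, 0 ≤ k ≤ j-1 }`; consequently `M = W_1 ⊕ ⋯ ⊕ W_l` is a
direct sum of `g`-invariant `𝓞`-submodules. -/
theorem standard_module_internal_direct_sum
    {K : Type*} [Field K] [NumberField K]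
    {M : Type*} [AddCommGroup M] [Module (𝓞 K) M]
    [Module.Free ℤ M] [Module.Finite ℤ M]
    (l : ℕ) (hl : 1 ≤ l) (g : M →ₗ[𝓞 K] M) (hg : g ^ l = 0)
    (hstd : ∀ i, 1 ≤ i → i ≤ l → Module.Free (𝓞 K) (Qquot g i))
    (r : ℕ → ℕ) (F : (j : ℕ) → Fin (r j) → M)
    (hF : ∀ j k, F j k ∈ kerPow g j)
    (hbasis : ∀ j, 1 ≤ j → j ≤ l →
      LinearIndependent (𝓞 K) (fun k : Fin (r j) =>
        (Submodule.Quotient.mk (⟨F j k, hF j k⟩ : ↥(kerPow g j)) : Qquot g j)) ∧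
      Submodule.span (𝓞 K) (Set.range (fun k : Fin (r j) =>
        (Submodule.Quotient.mk (⟨F j k, hF j k⟩ : ↥(kerPow g j)) : Qquot g j))) = ⊤)
    (U : ℕ → Submodule (𝓞 K) M)
    (hU : ∀ j, U j = Submodule.span (𝓞 K) (Set.range (F j)))
    (W : ℕ → Submodule (𝓞 K) M)
    (hW : ∀ j, W j = ⨆ k : Fin j, (U j).map (g ^ (k : ℕ))) :
    iSupIndep (fun p : {p : ℕ × ℕ // 1 ≤ p.1 ∧ p.1 ≤ l ∧ p.2 < p.1} =>
        (U p.1.1).map (g ^ p.1.2)) ∧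
    (⨆ p : {p : ℕ × ℕ // 1 ≤ p.1 ∧ p.1 ≤ l ∧ p.2 < p.1}, (U p.1.1).map (g ^ p.1.2)) = ⊤ ∧
    iSupIndep (fun j : {j : ℕ // 1 ≤ j ∧ j ≤ l} => W j.1) ∧
    (⨆ j : {j : ℕ // 1 ≤ j ∧ j ≤ l}, W j.1) = ⊤ ∧
    (∀ j, 1 ≤ j → j ≤ l → (W j).map g ≤ W j) := by
  have hUK : ∀ j, U j ≤ kerPow g j := by
    intro j
    rw [hU, Submodule.span_le]
    rintro _ ⟨k, rfl⟩
    exact hF j k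
  have hind := aux_indep l g U hUK (fun j h1 h2 x hx hx' =>
    aux_dis g j (r j) (F j) (hF j) (hbasis j h1 h2).1 x (hU j ▸ hx) hx')
  have htop := aux_top l g hg U (fun j h1 h2 => by
    rw [hU]; exact aux_spn g j (r j) (F j) (hF j) (hbasis j h1 h2).2)
  refine ⟨hind, ?_, ?_, ?_, ?_⟩
  · refine htop _ fun j k h1 h2 h3 => ?_
    exact le_iSup (fun p : {p : ℕ × ℕ // 1 ≤ p.1 ∧ p.1 ≤ l ∧ p.2 < p.1} =>
        (U p.1.1).map (g ^ p.1.2)) ⟨(j, k), h1, h2, h3⟩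
  · intro j
    have hd := hind.disjoint_biSup_biSup (s := {p | p.1.1 = j.1}) (t := {p | p.1.1 ≠ j.1})
      (by rw [Set.disjoint_left]; intro p h h'; exact h' h)
    refine hd.mono ?_ ?_
    · dsimp only
      rw [hW]
      refine iSup_le fun k => ?_
      exact le_iSup₂_of_le (⟨(j.1, k), j.2.1, j.2.2, k.2⟩ :
        {p : ℕ × ℕ // 1 ≤ p.1 ∧ p.1 ≤ l ∧ p.2 < p.1}) rfl le_rfl
    · refine iSup₂_le fun i hi => ?_
      dsimp only
      rw [hW]
      refine iSup_le fun k => ?_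
      exact le_iSup₂_of_le (⟨(i.1, k), i.2.1, i.2.2, k.2⟩ :
        {p : ℕ × ℕ // 1 ≤ p.1 ∧ p.1 ≤ l ∧ p.2 < p.1}) (fun h => hi (Subtype.ext h)) le_rfl
  · refine htop _ fun j k h1 h2 h3 => ?_
    refine le_trans ?_ (le_iSup (fun j : {j : ℕ // 1 ≤ j ∧ j ≤ l} => W j.1) ⟨j, h1, h2⟩)
    dsimp only
    rw [hW]
    exact le_iSup (fun k : Fin j => (U j).map (g ^ (k : ℕ))) ⟨k, h3⟩
  · intro j _ _
    rw [hW, Submodule.map_iSup]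
    refine iSup_le fun k => ?_
    rintro _ ⟨_, ⟨u, hu, rfl⟩, rfl⟩
    have e : g ((g ^ (k : ℕ)) u) = (g ^ ((k : ℕ) + 1)) u := by rw [pow_succ']; rfl
    rw [e]
    by_cases h : (k : ℕ) + 1 < j
    · exact Submodule.mem_iSup_of_mem (⟨(k : ℕ) + 1, h⟩ : Fin j) (Submodule.mem_map_of_mem hu)
    · have h0 : (k : ℕ) + 1 = j := by have := k.2; omega
      rw [h0, (aux_mem_kerPow g j u).1 (hUK j hu)]
      exact Submodule.zero_mem _
end

section
/- Let (M,g) be a standard P_l(𝓞)-module. Every α ∈ Aut(M) preserves each K_i(M) and each L_i(M) and hence induces an 𝓞-module automorphism of Q_i(M); let ρ : Aut(M) → Aut_𝓞(Q_1(M)) × ⋯ × Aut_𝓞(Q_l(M)) be the resulting group homomorphism. Then ρ is surjective, and moreover there exists a group homomorphism σ : Aut_𝓞(Q_1(M)) × ⋯ × Aut_𝓞(Q_l(M)) → Aut(M) with ρ ∘ σ the identity; in particular Aut(M) splits over ker(ρ). -/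
open NumberField

/-- The group of `P_l(𝓞)`-module automorphisms of `(M,g)`: `𝓞`-linear automorphisms of `M`
commuting with `g`, as a subgroup of the `𝓞`-linear automorphism group of `M`. -/
def AutP {R M : Type*} [CommRing R] [AddCommGroup M] [Module R M]
    (g : M →ₗ[R] M) : Subgroup (M ≃ₗ[R] M) where
  carrier := {α | ∀ x, α (g x) = g (α x)}
  one_mem' := fun _ => rfl
  mul_mem' := by
    intro a b ha hb x
    show a (b (g x)) = g (a (b x))
    rw [hb, ha]
  inv_mem' := by
    intro a ha x
    show a.symm (g x) = g (a.symm x)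
    have h1 : a (g (a.symm x)) = g x := by
      rw [ha (a.symm x), a.apply_symm_apply]
    rw [← h1, a.symm_apply_apply]

section Helpers

variable {R M : Type*} [CommRing R] [AddCommGroup M] [Module R M]

lemma autP_pow (g : M →ₗ[R] M) (α : M ≃ₗ[R] M) (h : ∀ x, α (g x) = g (α x)) (n : ℕ) (x : M) :
    α ((g ^ n) x) = (g ^ n) (α x) := by
  induction n generalizing x with
  | zero => simp
  | succ n ih => rw [pow_succ, Module.End.mul_apply, Module.End.mul_apply, ih, h]

lemma kerPow_map_aut (g : M →ₗ[R] M) (α : M ≃ₗ[R] M) (h : ∀ x, α (g x) = g (α x)) (i : ℕ) :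
    (kerPow g i).map (α : M →ₗ[R] M) = kerPow g i := by
  ext y
  simp only [Submodule.mem_map, kerPow, LinearMap.mem_ker, LinearEquiv.coe_coe]
  constructor
  · rintro ⟨x, hx, rfl⟩
    rw [← autP_pow g α h, hx, map_zero]
  · intro hy
    refine ⟨α.symm y, ?_, α.apply_symm_apply y⟩
    apply α.injective
    rw [autP_pow g α h, α.apply_symm_apply, hy, map_zero]

lemma Lsub_map_aut (g : M →ₗ[R] M) (α : M ≃ₗ[R] M) (h : ∀ x, α (g x) = g (α x)) (i : ℕ) :
    (Lsub g i).map (α : M →ₗ[R] M) = Lsub g i := by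
  have hc : (α : M →ₗ[R] M) ∘ₗ g = g ∘ₗ (α : M →ₗ[R] M) := LinearMap.ext h
  rw [Lsub, Submodule.map_sup, kerPow_map_aut g α h, ← Submodule.map_comp, hc,
    Submodule.map_comp, kerPow_map_aut g α h]

/-- The automorphism of `K_i` induced by `α`. -/
noncomputable def kerEquiv (g : M →ₗ[R] M) (α : AutP g) (i : ℕ) : kerPow g i ≃ₗ[R] kerPow g i :=
  (α : M ≃ₗ[R] M).ofSubmodules _ _ (kerPow_map_aut g α α.2 i)

lemma kerEquiv_coe (g : M →ₗ[R] M) (α : AutP g) (i : ℕ) (x : kerPow g i) :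
    (kerEquiv g α i x : M) = (α : M ≃ₗ[R] M) x := rfl

/-- The automorphism of `Q_i` induced by `α`. -/
noncomputable def quotEquiv (g : M →ₗ[R] M) (α : AutP g) (i : ℕ) : Qquot g i ≃ₗ[R] Qquot g i :=
  Submodule.Quotient.equiv _ _ (kerEquiv g α i) (by
    ext y
    simp only [Submodule.mem_map, Submodule.mem_comap, Submodule.subtype_apply,
      LinearEquiv.coe_coe]
    constructor
    · rintro ⟨x, hx, rfl⟩
      rw [kerEquiv_coe, ← Lsub_map_aut g α α.2 i]
      exact ⟨_, hx, rfl⟩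
    · intro hy
      refine ⟨(kerEquiv g α i).symm y, ?_, LinearEquiv.apply_symm_apply _ _⟩
      rw [← Lsub_map_aut g α α.2 i] at hy
      obtain ⟨x, hx, hxy⟩ := hy
      have : (((kerEquiv g α i).symm y : kerPow g i) : M) = x := by
        apply (α : M ≃ₗ[R] M).injective
        rw [← kerEquiv_coe, LinearEquiv.apply_symm_apply]
        exact hxy.symm
      rw [this]
      exact hx)

lemma quotEquiv_mk (g : M →ₗ[R] M) (α : AutP g) (i : ℕ) (x : kerPow g i) :
    quotEquiv g α i (Submodule.Quotient.mk x) = Submodule.Quotient.mk (kerEquiv g α i x) := rfl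

/-- The homomorphism `ρ`. -/
noncomputable def rhoHom (g : M →ₗ[R] M) (l : ℕ) :
    AutP g →* (∀ i : Fin l, (Qquot g (i.1 + 1) ≃ₗ[R] Qquot g (i.1 + 1))) :=
  MonoidHom.mk' (fun α i => quotEquiv g α (i.1 + 1)) (by
    intro a b
    funext i
    apply LinearEquiv.ext
    intro q
    obtain ⟨x, rfl⟩ := Submodule.Quotient.mk_surjective _ q
    rfl)

variable {l : ℕ} {Q : Fin l → Type*} [∀ i, AddCommGroup (Q i)] [∀ i, Module R (Q i)]

/-- The map `Φ(v) = ∑ g^j s_i v_{ij}`. -/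
noncomputable def modelMap (g : M →ₗ[R] M) (s : ∀ i, Q i →ₗ[R] M) :
    (∀ i : Fin l, Fin (i.1 + 1) → Q i) →ₗ[R] M :=
  ∑ i : Fin l, ∑ j : Fin (i.1 + 1),
    (g ^ j.1) ∘ₗ (s i) ∘ₗ (LinearMap.proj j) ∘ₗ (LinearMap.proj i)

lemma modelMap_apply (g : M →ₗ[R] M) (s : ∀ i, Q i →ₗ[R] M)
    (v : ∀ i : Fin l, Fin (i.1 + 1) → Q i) :
    modelMap g s v = ∑ i : Fin l, ∑ j : Fin (i.1 + 1), (g ^ j.1) (s i (v i j)) := by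
  simp [modelMap, LinearMap.sum_apply]

lemma modelMap_single (g : M →ₗ[R] M) (s : ∀ i, Q i →ₗ[R] M) (i : Fin l) (j : Fin (i.1 + 1))
    (q : Q i) : modelMap g s (Pi.single i (Pi.single j q)) = (g ^ j.1) (s i q) := by
  rw [modelMap_apply, Finset.sum_eq_single i, Finset.sum_eq_single j]
  · simp
  · intro b _ hb
    simp [Pi.single_eq_of_ne hb]
  · simp
  · intro b _ hb
    simp [Pi.single_eq_of_ne hb]
  · simp

lemma pow_zero_of_le (g : M →ₗ[R] M) {m n : ℕ} (h : m ≤ n) {x : M} (hx : (g ^ m) x = 0) :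
    (g ^ n) x = 0 := by
  obtain ⟨k, rfl⟩ := Nat.exists_eq_add_of_le' h
  rw [pow_add, Module.End.mul_apply, hx, map_zero]

lemma gen_mem_range (g : M →ₗ[R] M) (s : ∀ i, Q i →ₗ[R] M)
    (h1 : ∀ i q, (g ^ (i.1 + 1)) (s i q) = 0) (i : Fin l) (n : ℕ) (q : Q i) :
    (g ^ n) (s i q) ∈ LinearMap.range (modelMap g s) := by
  by_cases hn : n < i.1 + 1
  · exact ⟨_, modelMap_single g s i ⟨n, hn⟩ q⟩
  · rw [pow_zero_of_le g (not_lt.mp hn) (h1 i q)]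
    exact zero_mem _

lemma range_stable (g : M →ₗ[R] M) (s : ∀ i, Q i →ₗ[R] M)
    (h1 : ∀ i q, (g ^ (i.1 + 1)) (s i q) = 0) (x : M)
    (hx : x ∈ LinearMap.range (modelMap g s)) : g x ∈ LinearMap.range (modelMap g s) := by
  obtain ⟨v, rfl⟩ := hx
  rw [modelMap_apply, map_sum]
  refine Submodule.sum_mem _ fun i _ => ?_
  rw [map_sum]
  refine Submodule.sum_mem _ fun j _ => ?_
  rw [← Module.End.mul_apply, ← pow_succ']
  exact gen_mem_range g s h1 i _ _

lemma modelMap_surjective (g : M →ₗ[R] M) (hg : g ^ l = 0) (s : ∀ i, Q i →ₗ[R] M)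
    (h1 : ∀ i q, (g ^ (i.1 + 1)) (s i q) = 0)
    (h3 : ∀ i : Fin l, ∀ x ∈ kerPow g (i.1 + 1), ∃ q, x - s i q ∈ Lsub g (i.1 + 1)) :
    Function.Surjective (modelMap g s) := by
  set S := LinearMap.range (modelMap g s) with hS
  have key : ∀ n ≤ l, ∀ x ∈ kerPow g n, ∃ y ∈ S, ∃ z, x = y + g z := by
    intro n
    induction n with
    | zero =>
      intro _ x hx
      have : x = 0 := by simpa [kerPow] using hx
      exact ⟨0, zero_mem _, 0, by simp [this]⟩
    | succ n ih =>
      intro hn x hx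
      obtain ⟨q, hq⟩ := h3 ⟨n, hn⟩ x hx
      rw [Lsub, Submodule.mem_sup] at hq
      obtain ⟨a, ⟨b, _, rfl⟩, c, hc, hac⟩ := hq
      obtain ⟨y, hy, z, rfl⟩ := ih (by omega) c hc
      have h0 : s ⟨n, hn⟩ q ∈ S := by
        have := gen_mem_range g s h1 ⟨n, hn⟩ 0 q
        rwa [pow_zero, Module.End.one_apply] at this
      refine ⟨s ⟨n, hn⟩ q + y, add_mem h0 hy, b + z, ?_⟩
      rw [map_add, eq_add_of_sub_eq hac.symm]
      abel
  have key2 : ∀ x, ∃ y ∈ S, ∃ z, x = y + g z := fun x =>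
    key l le_rfl x (by simp [kerPow, hg])
  have key3 : ∀ n : ℕ, ∀ x, ∃ y ∈ S, ∃ z, x = y + (g ^ n) z := by
    intro n
    induction n with
    | zero => exact fun x => ⟨0, zero_mem _, x, by simp⟩
    | succ n ih =>
      intro x
      obtain ⟨y, hy, z, rfl⟩ := key2 x
      obtain ⟨y', hy', z', rfl⟩ := ih z
      refine ⟨y + g y', add_mem hy (range_stable g s h1 _ hy'), z', ?_⟩
      rw [map_add, pow_succ', Module.End.mul_apply, add_assoc]
  intro x
  obtain ⟨y, hy, z, rfl⟩ := key3 l x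
  rw [hg, LinearMap.zero_apply, add_zero]
  exact hy

lemma top_injective (g : M →ₗ[R] M) (s : ∀ i, Q i →ₗ[R] M)
    (h1 : ∀ i q, (g ^ (i.1 + 1)) (s i q) = 0)
    (h2 : ∀ i : Fin l, ∀ q, s i q ∈ Lsub g (i.1 + 1) → q = 0)
    (a : ∀ i, Q i) (ha : ∑ i : Fin l, (g ^ i.1) (s i (a i)) = 0) : ∀ i, a i = 0 := by
  have main : ∀ n : ℕ, ∀ i : Fin l, i.1 = n → a i = 0 := by
    intro n
    induction n using Nat.strong_induction_on with
    | _ n ih =>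
      rintro i rfl
      apply h2 i
      -- the tail
      set t : M := ∑ k : Fin l, if i.1 < k.1 then (g ^ (k.1 - i.1 - 1)) (s k (a k)) else 0 with ht
      have htK : t ∈ kerPow g (i.1 + 1 + 1) := by
        refine Submodule.sum_mem _ fun k _ => ?_
        split_ifs with hk
        · rw [kerPow, LinearMap.mem_ker, ← Module.End.mul_apply, ← pow_add]
          exact pow_zero_of_le g (by omega) (h1 k (a k))
        · exact zero_mem _
      have hsum : (g ^ i.1) (s i (a i) + g t) = 0 := by
        rw [← ha, map_add, ← Module.End.mul_apply (g ^ i.1) g, ← pow_succ, ht, map_sum,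
          ← Finset.add_sum_erase _ _ (Finset.mem_univ i),
          ← Finset.add_sum_erase (a := i) _ (fun k : Fin l => (g ^ k.1) (s k (a k)))
            (Finset.mem_univ i)]
        simp only [lt_irrefl, if_false, map_zero, zero_add]
        congr 1
        refine Finset.sum_congr rfl fun k hk => ?_
        have hne : k.1 ≠ i.1 := fun h => (Finset.ne_of_mem_erase hk) (Fin.ext h)
        split_ifs with hlt
        · rw [← Module.End.mul_apply, ← pow_add]
          congr 2
          omega
        · rw [ih k.1 (by omega) k rfl]
          simp
      rw [Lsub, Submodule.mem_sup]
      refine ⟨g (-t), ⟨-t, neg_mem htK, rfl⟩, s i (a i) + g t, ?_, by rw [map_neg]; abel⟩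
      simpa [kerPow] using hsum
  exact fun i => main i.1 i rfl

lemma modelMap_injective (g : M →ₗ[R] M) (s : ∀ i, Q i →ₗ[R] M)
    (h1 : ∀ i q, (g ^ (i.1 + 1)) (s i q) = 0)
    (h2 : ∀ i : Fin l, ∀ q, s i q ∈ Lsub g (i.1 + 1) → q = 0) :
    Function.Injective (modelMap g s) := by
  rw [injective_iff_map_eq_zero]
  intro v hv
  rw [modelMap_apply] at hv
  have main : ∀ n : ℕ, ∀ (i : Fin l) (j : Fin (i.1 + 1)), l - (i.1 - j.1) = n → v i j = 0 := by
    intro n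
    induction n using Nat.strong_induction_on with
    | _ n ih =>
      rintro i j rfl
      set e := i.1 - j.1 with he
      let a : ∀ k, Q k := fun k => if h : e ≤ k.1 then v k ⟨k.1 - e, by omega⟩ else 0
      have hz : ∀ k, a k = 0 := by
        apply top_injective g s h1 h2 a
        have := congrArg (g ^ e) hv
        rw [map_sum, map_zero] at this
        rw [← this]
        refine Finset.sum_congr rfl fun k _ => ?_
        rw [map_sum]
        have hterm : ∀ m : Fin (k.1 + 1), m.1 + e ≠ k.1 → (g ^ e) ((g ^ m.1) (s k (v k m))) = 0 := by
          intro m hm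
          by_cases hlt : m.1 + e < k.1
          · rw [ih (l - (k.1 - m.1)) (by omega) k m rfl]
            simp
          · rw [← Module.End.mul_apply, ← pow_add]
            exact pow_zero_of_le g (by omega) (h1 k _)
        by_cases h : e ≤ k.1
        · rw [Finset.sum_eq_single (⟨k.1 - e, by omega⟩ : Fin (k.1 + 1))]
          · simp only [a, dif_pos h]
            rw [← Module.End.mul_apply, ← pow_add]
            congr 2
            omega
          · intro m _ hm
            apply hterm
            intro h'
            apply hm
            apply Fin.ext
            simp only
            omega
          · simp
        · simp only [a, dif_neg h, map_zero]
          symm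
          exact Finset.sum_eq_zero fun m _ => hterm m (by omega)
      have := hz i
      simp only [a] at this
      rw [dif_pos (by omega)] at this
      convert this using 2
      apply Fin.ext
      simp only
      omega
  funext i j
  exact main _ i j rfl

/-- Diagonal action on the model. -/
def diagHom (R : Type*) [CommRing R] (Q : Fin l → Type*) [∀ i, AddCommGroup (Q i)]
    [∀ i, Module R (Q i)] :
    (∀ i, Q i ≃ₗ[R] Q i) →* ((∀ i : Fin l, Fin (i.1 + 1) → Q i) ≃ₗ[R]
      (∀ i : Fin l, Fin (i.1 + 1) → Q i)) where
  toFun φ := LinearEquiv.piCongrRight fun i => LinearEquiv.piCongrRight fun _ => φ i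
  map_one' := rfl
  map_mul' _ _ := rfl

lemma exists_splitting (g : M →ₗ[R] M) (hg : g ^ l = 0) (s : ∀ i, Q i →ₗ[R] M)
    (h1 : ∀ i q, (g ^ (i.1 + 1)) (s i q) = 0)
    (h2 : ∀ i : Fin l, ∀ q, s i q ∈ Lsub g (i.1 + 1) → q = 0)
    (h3 : ∀ i : Fin l, ∀ x ∈ kerPow g (i.1 + 1), ∃ q, x - s i q ∈ Lsub g (i.1 + 1)) :
    ∃ σ : (∀ i, Q i ≃ₗ[R] Q i) →* AutP g,
      ∀ φ i q, (σ φ : M ≃ₗ[R] M) (s i q) = s i (φ i q) := by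
  let e := LinearEquiv.ofBijective (modelMap g s)
    ⟨modelMap_injective g s h1 h2, modelMap_surjective g hg s h1 h3⟩
  let τ : (∀ i, Q i ≃ₗ[R] Q i) → (M ≃ₗ[R] M) := fun φ =>
    (e.symm.trans (diagHom R Q φ)).trans e
  have hτ : ∀ φ v, τ φ (modelMap g s v) = modelMap g s (diagHom R Q φ v) := by
    intro φ v
    change e (diagHom R Q φ (e.symm (e v))) = _
    rw [e.symm_apply_apply]
    rfl
  have hgen : ∀ φ i n q, τ φ ((g ^ n) (s i q)) = (g ^ n) (s i (φ i q)) := by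
    intro φ i n q
    by_cases hn : n < i.1 + 1
    · have := hτ φ (Pi.single i (Pi.single (⟨n, hn⟩ : Fin (i.1 + 1)) q))
      rw [modelMap_single] at this
      refine this.trans ?_
      rw [← modelMap_single g s i ⟨n, hn⟩]
      congr 1
      funext k m
      change φ k _ = _
      by_cases hk : k = i
      · subst hk
        by_cases hm : m = ⟨n, hn⟩
        · subst hm
          simp
        · simp [Pi.single_eq_of_ne hm]
      · simp [Pi.single_eq_of_ne hk]
    · rw [pow_zero_of_le g (not_lt.mp hn) (h1 i q), pow_zero_of_le g (not_lt.mp hn) (h1 i _),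
        map_zero]
  have hcomm : ∀ φ, τ φ ∈ AutP g := by
    intro φ x
    obtain ⟨v, rfl⟩ := e.surjective x
    change τ φ (g (modelMap g s v)) = g (τ φ (modelMap g s v))
    simp only [modelMap_apply, map_sum]
    refine Finset.sum_congr rfl fun i _ => Finset.sum_congr rfl fun j _ => ?_
    rw [hgen, ← Module.End.mul_apply, ← pow_succ', hgen, pow_succ', Module.End.mul_apply]
  refine ⟨MonoidHom.mk' (fun φ => ⟨τ φ, hcomm φ⟩) ?_, ?_⟩
  · intro φ ψ
    apply Subtype.ext
    apply LinearEquiv.ext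
    intro x
    change e (diagHom R Q (φ * ψ) (e.symm x)) =
      e (diagHom R Q φ (e.symm (e (diagHom R Q ψ (e.symm x)))))
    rw [e.symm_apply_apply, map_mul]
    rfl
  · intro φ i q
    simpa using hgen φ i 0 q

end Helpers

/-- For a standard `P_l(𝓞)`-module `(M,g)`, every automorphism preserves
each `K_i` and `L_i`, hence induces an automorphism of each `Q_i`; the resulting group
homomorphism `ρ : Aut(M) → Aut_𝓞(Q_1) × ⋯ × Aut_𝓞(Q_l)` is surjective and splits. -/
theorem rho_surjective_and_splits
    {K : Type*} [Field K] [NumberField K]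
    {M : Type*} [AddCommGroup M] [Module (𝓞 K) M]
    [Module.Free ℤ M] [Module.Finite ℤ M]
    (l : ℕ) (hl : 1 ≤ l) (g : M →ₗ[𝓞 K] M) (hg : g ^ l = 0)
    (hstd : ∀ i, 1 ≤ i → i ≤ l → Module.Free (𝓞 K) (Qquot g i)) :
    (∀ α : M ≃ₗ[𝓞 K] M, (∀ x, α (g x) = g (α x)) → ∀ i : ℕ,
        (kerPow g i).map (α : M →ₗ[𝓞 K] M) = kerPow g i ∧
        (Lsub g i).map (α : M →ₗ[𝓞 K] M) = Lsub g i) ∧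
    ∃ ρ : AutP g →* (∀ i : Fin l, (Qquot g (i.1 + 1) ≃ₗ[𝓞 K] Qquot g (i.1 + 1))),
      (∀ (α : AutP g) (i : Fin l) (x : ↥(kerPow g (i.1 + 1)))
          (hx : (α : M ≃ₗ[𝓞 K] M) (x : M) ∈ kerPow g (i.1 + 1)),
          ρ α i (Submodule.Quotient.mk x) =
            Submodule.Quotient.mk ⟨(α : M ≃ₗ[𝓞 K] M) (x : M), hx⟩) ∧
      Function.Surjective ρ ∧
      ∃ σ : (∀ i : Fin l, (Qquot g (i.1 + 1) ≃ₗ[𝓞 K] Qquot g (i.1 + 1))) →* AutP g,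
        ρ.comp σ = MonoidHom.id _ := by
  refine ⟨fun α h i => ⟨kerPow_map_aut g α h i, Lsub_map_aut g α h i⟩, rhoHom g l, ?_, ?_⟩
  · intro α i x hx
    rfl
  · have hsec : ∀ i : Fin l, ∃ t : Qquot g (i.1 + 1) →ₗ[𝓞 K] kerPow g (i.1 + 1),
        (Submodule.mkQ _) ∘ₗ t = LinearMap.id := by
      intro i
      have := hstd (i.1 + 1) (by omega) (by omega)
      exact Module.projective_lifting_property _ _ (Submodule.mkQ_surjective _)
    choose t ht using hsec
    have ht' : ∀ i q, (Submodule.Quotient.mk (t i q) : Qquot g (i.1 + 1)) = q :=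
      fun i q => LinearMap.congr_fun (ht i) q
    obtain ⟨σ, hσ⟩ := exists_splitting (Q := fun i : Fin l => Qquot g (i.1 + 1)) g hg
      (fun i => (kerPow g (i.1 + 1)).subtype ∘ₗ t i)
      (fun i q => (t i q).2)
      (fun i q hq => by
        rw [← ht' i q]
        exact (Submodule.Quotient.mk_eq_zero _).mpr hq)
      (fun i x hx => by
        refine ⟨Submodule.Quotient.mk ⟨x, hx⟩, ?_⟩
        have := (Submodule.Quotient.eq _).mp (ht' i (Submodule.Quotient.mk ⟨x, hx⟩)).symm
        exact this)
    have hid : (rhoHom g l).comp σ = MonoidHom.id _ := by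
      apply MonoidHom.ext
      intro φ
      funext i
      apply LinearEquiv.ext
      intro q
      change quotEquiv g (σ φ) (i.1 + 1) q = φ i q
      have hk : kerEquiv g (σ φ) (i.1 + 1) (t i q) = t i (φ i q) := Subtype.ext (hσ φ i q)
      conv_lhs => rw [← ht' i q]
      rw [quotEquiv_mk, hk, ht']
    exact ⟨fun φ => ⟨σ φ, DFunLike.congr_fun hid φ⟩, σ, hid⟩
end

section
/- Let (M,g) be a standard P_l(𝓞)-module, and for 1 ≤ j ≤ l let F_j ⊆ K_j(M) be a finite set whose image under the projection K_j(M) → Q_j(M) is a free 𝓞-basis of Q_j(M). For each 1 ≤ j ≤ l and each f ∈ F_j choose an arbitrary element t_f ∈ L_j(M). Then there exists α ∈ Aut(M) (an 𝓞-linear automorphism of M commuting with g) such that α(f) = f + t_f for every j and every f ∈ F_j, and α induces the identity map on every quotient Q_i(M), 1 ≤ i ≤ l. -/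
open NumberField

section Helpers

variable {R M : Type*} [CommRing R] [AddCommGroup M] [Module R M] (g : M →ₗ[R] M)

theorem mem_kerPow {i : ℕ} {x : M} : x ∈ kerPow g i ↔ (g ^ i) x = 0 := Iff.rfl

theorem kerPow_mono {i j : ℕ} (h : i ≤ j) : kerPow g i ≤ kerPow g j := by
  intro x hx
  rw [mem_kerPow] at *
  obtain ⟨d, rfl⟩ := Nat.exists_eq_add_of_le h
  rw [add_comm, pow_add, Module.End.mul_apply, hx, map_zero]

theorem apply_mem_kerPow_iff {i : ℕ} {x : M} : g x ∈ kerPow g i ↔ x ∈ kerPow g (i + 1) := by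
  rw [mem_kerPow, mem_kerPow, pow_succ, Module.End.mul_apply]

theorem pow_apply_mem_kerPow {i s : ℕ} {x : M} (hx : x ∈ kerPow g (i + s)) :
    (g ^ s) x ∈ kerPow g i := by
  rw [mem_kerPow] at *
  rw [← Module.End.mul_apply, ← pow_add, hx]

theorem Lsub_le_kerPow {i : ℕ} : Lsub g i ≤ kerPow g i := by
  refine sup_le ?_ (kerPow_mono g (Nat.sub_le _ _))
  rintro _ ⟨x, hx, rfl⟩
  exact (apply_mem_kerPow_iff g).2 hx

theorem apply_mem_Lsub {i : ℕ} (hi : 1 ≤ i) {x : M} (hx : x ∈ Lsub g (i + 1)) :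
    g x ∈ Lsub g i := by
  have : x ∈ kerPow g (i + 1) := Lsub_le_kerPow g hx
  exact Submodule.mem_sup_left ⟨x, this, rfl⟩

theorem span_all {l : ℕ} (hg : g ^ l = 0) {r : ℕ → ℕ} (G : (j : ℕ) → Fin (r j) → M)
    (hG : ∀ j, 1 ≤ j → j ≤ l → kerPow g j ≤ Submodule.span R (Set.range (G j)) ⊔ Lsub g j)
    (S : Submodule R M) (hS : ∀ x ∈ S, g x ∈ S)
    (hGS : ∀ j, 1 ≤ j → j ≤ l → ∀ k, G j k ∈ S) : S = ⊤ := by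
  have top : kerPow g l = ⊤ := by
    rw [kerPow, hg, LinearMap.ker_zero]
  have key : ∀ n i, i + n = l + 1 → 1 ≤ i → kerPow g i ≤ S ⊔ kerPow g (i - 1) := by
    intro n
    induction n with
    | zero =>
      intro i hi h1
      have : i - 1 = l := by omega
      rw [this, top]
      simp
    | succ n ih =>
      intro i hi h1
      have ih' := ih (i + 1) (by omega) (by omega)
      rw [Nat.add_sub_cancel] at ih'
      refine (hG i h1 (by omega)).trans (sup_le ?_ (sup_le ?_ le_sup_right))
      · refine le_trans (Submodule.span_le.2 ?_) le_sup_left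
        rintro _ ⟨k, rfl⟩
        exact hGS i h1 (by omega) k
      · rintro _ ⟨x, hx, rfl⟩
        obtain ⟨a, ha, b, hb, rfl⟩ := Submodule.mem_sup.1 (ih' hx)
        rw [map_add]
        refine Submodule.add_mem_sup (hS a ha) ?_
        rw [apply_mem_kerPow_iff, Nat.sub_add_cancel h1]
        exact hb
  have key2 : ∀ i, i ≤ l → kerPow g i ≤ S := by
    intro i
    induction i with
    | zero =>
      intro _ x hx
      have : x = 0 := by simpa [mem_kerPow] using hx
      rw [this]
      exact S.zero_mem
    | succ i ih =>
      intro hi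
      exact (key (l - i) (i + 1) (by omega) (by omega)).trans
        (sup_le le_rfl (ih (by omega)))
  rw [eq_top_iff, ← top]
  exact key2 l le_rfl

theorem indep_layer {l : ℕ} {r : ℕ → ℕ} (F : (j : ℕ) → Fin (r j) → M)
    (hF : ∀ j k, F j k ∈ kerPow g j)
    (hind : ∀ j, 1 ≤ j → j ≤ l → ∀ c : Fin (r j) → R,
      ∑ k, c k • F j k ∈ Lsub g j → c = 0)
    (d : (j : ℕ) → Fin (r j) → R) :
    ∀ n h, h + n = l + 1 → 1 ≤ h →
      ∑ j ∈ Finset.Ico h (l + 1), (g ^ (j - h)) (∑ k, d j k • F j k) ∈ kerPow g (h - 1) →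
      ∀ j, h ≤ j → j ≤ l → d j = 0 := by
  intro n
  induction n with
  | zero => intro h hn h1 _ j hj hjl; omega
  | succ n ih =>
    intro h hn h1 hm
    have hw : ∑ j ∈ Finset.Ico (h + 1) (l + 1), (g ^ (j - h)) (∑ k, d j k • F j k)
        = g (∑ j ∈ Finset.Ico (h + 1) (l + 1), (g ^ (j - (h + 1))) (∑ k, d j k • F j k)) := by
      rw [map_sum]
      refine Finset.sum_congr rfl fun j hj => ?_
      rw [Finset.mem_Ico] at hj
      have : j - h = (j - (h + 1)) + 1 := by omega
      rw [this, pow_succ', Module.End.mul_apply]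
    rw [Finset.sum_eq_sum_Ico_succ_bot (by omega), hw, Nat.sub_self, pow_zero,
      Module.End.one_apply] at hm
    set w := ∑ j ∈ Finset.Ico (h + 1) (l + 1), (g ^ (j - (h + 1))) (∑ k, d j k • F j k)
      with hwdef
    have hwK : w ∈ kerPow g (h + 1) := by
      refine Submodule.sum_mem _ fun j hj => ?_
      rw [Finset.mem_Ico] at hj
      refine pow_apply_mem_kerPow g ?_
      rw [Nat.add_sub_cancel' hj.1]
      exact Submodule.sum_mem _ fun k _ => Submodule.smul_mem _ _ (hF j k)
    have hd : d h = 0 := by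
      refine hind h h1 (by omega) _ ?_
      rw [← add_sub_cancel_right (∑ k, d h k • F h k) (g w)]
      exact Submodule.sub_mem _ (Submodule.mem_sup_right hm)
        (Submodule.mem_sup_left ⟨w, hwK, rfl⟩)
    have hz : ∑ k, d h k • F h k = 0 := by simp [hd]
    rw [hz, zero_add, apply_mem_kerPow_iff, Nat.sub_add_cancel h1] at hm
    intro j hj hjl
    rcases Nat.eq_or_lt_of_le hj with rfl | hlt
    · exact hd
    · exact ih (h + 1) (by omega) (by omega) (by rw [Nat.add_sub_cancel]; exact hm) j hlt hjl

/-- The layer of height `h`. -/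
noncomputable def layerMap (l : ℕ) {r : ℕ → ℕ} (G : (j : ℕ) → Fin (r j) → M) (h : ℕ) :
    (ℕ → (j : ℕ) → Fin (r j) → R) →ₗ[R] M where
  toFun c := ∑ j ∈ Finset.Ico h (l + 1), (g ^ (j - h)) (∑ k, c h j k • G j k)
  map_add' c d := by
    simp [add_smul, Finset.sum_add_distrib]
  map_smul' a c := by
    simp [Finset.smul_sum, mul_smul]

theorem layerMap_apply (l : ℕ) {r : ℕ → ℕ} (G : (j : ℕ) → Fin (r j) → M) (h : ℕ)
    (c : ℕ → (j : ℕ) → Fin (r j) → R) : layerMap g l G h c =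
      ∑ j ∈ Finset.Ico h (l + 1), (g ^ (j - h)) (∑ k, c h j k • G j k) := rfl

theorem indep_all {l : ℕ} {r : ℕ → ℕ} (F : (j : ℕ) → Fin (r j) → M)
    (hF : ∀ j k, F j k ∈ kerPow g j)
    (hind : ∀ j, 1 ≤ j → j ≤ l → ∀ c : Fin (r j) → R,
      ∑ k, c k • F j k ∈ Lsub g j → c = 0)
    (c : ℕ → (j : ℕ) → Fin (r j) → R) :
    ∀ m, m ≤ l → ∑ h ∈ Finset.Ico 1 (m + 1), layerMap g l F h c = 0 →
      ∀ h, 1 ≤ h → h ≤ m → ∀ j, h ≤ j → j ≤ l → c h j = 0 := by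
  have hK : ∀ h, layerMap g l F h c ∈ kerPow g h := by
    intro h
    rw [layerMap_apply]
    refine Submodule.sum_mem _ fun j hj => ?_
    rw [Finset.mem_Ico] at hj
    refine pow_apply_mem_kerPow g ?_
    rw [Nat.add_sub_cancel' hj.1]
    exact Submodule.sum_mem _ fun k _ => Submodule.smul_mem _ _ (hF j k)
  intro m
  induction m with
  | zero => intro _ _ h h1 h2; omega
  | succ m ih =>
    intro hm hs
    rw [Finset.sum_Ico_succ_top (by omega)] at hs
    have hmem : layerMap g l F (m + 1) c ∈ kerPow g m := by
      rw [eq_neg_of_add_eq_zero_right hs]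
      refine Submodule.neg_mem _ (Submodule.sum_mem _ fun h hh => ?_)
      rw [Finset.mem_Ico] at hh
      exact kerPow_mono g (by omega) (hK h)
    have hc := indep_layer g F hF hind (c (m + 1)) (l - m) (m + 1) (by omega) (by omega) hmem
    have hz : layerMap g l F (m + 1) c = 0 := by
      rw [layerMap_apply]
      refine Finset.sum_eq_zero fun j hj => ?_
      rw [Finset.mem_Ico] at hj
      simp [hc j hj.1 (by omega)]
    rw [hz, add_zero] at hs
    intro h h1 h2
    rcases Nat.eq_or_lt_of_le h2 with rfl | hlt
    · exact hc
    · exact ih (by omega) hs h h1 (by omega)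

/-- The total parametrization. -/
noncomputable def totalMap (l : ℕ) {r : ℕ → ℕ} (G : (j : ℕ) → Fin (r j) → M) :
    (ℕ → (j : ℕ) → Fin (r j) → R) →ₗ[R] M :=
  ∑ h ∈ Finset.Ico 1 (l + 1), layerMap g l G h

theorem totalMap_single {l : ℕ} {r : ℕ → ℕ} (G : (j : ℕ) → Fin (r j) → M)
    (s j : ℕ) (hs : s < j) (hj : j ≤ l) (k : Fin (r j)) :
    totalMap g l G (Pi.single (j - s) (Pi.single j (Pi.single k 1))) = (g ^ s) (G j k) := by
  rw [totalMap, LinearMap.sum_apply, Finset.sum_eq_single (j - s)]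
  · change ∑ j' ∈ Finset.Ico (j - s) (l + 1), _ = _
    rw [Finset.sum_eq_single j]
    · have : j - (j - s) = s := by omega
      rw [this, Pi.single_eq_same, Pi.single_eq_same, Finset.sum_eq_single k]
      · simp
      · intro b _ hb
        simp [Pi.single_eq_of_ne hb]
      · simp
    · intro b _ hb
      simp [Pi.single_eq_of_ne hb]
    · intro h
      exact absurd (Finset.mem_Ico.2 ⟨by omega, by omega⟩) h
  · intro b _ hb
    change ∑ j' ∈ Finset.Ico b (l + 1), _ = _
    simp [Pi.single_eq_of_ne hb]
  · intro h
    exact absurd (Finset.mem_Ico.2 ⟨by omega, by omega⟩) h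

theorem span_pows {l : ℕ} (hg : g ^ l = 0) {r : ℕ → ℕ} (G : (j : ℕ) → Fin (r j) → M)
    (hGK : ∀ j, 1 ≤ j → j ≤ l → ∀ k, G j k ∈ kerPow g j)
    (hG : ∀ j, 1 ≤ j → j ≤ l → kerPow g j ≤ Submodule.span R (Set.range (G j)) ⊔ Lsub g j) :
    Submodule.span R {x | ∃ s j k, 1 ≤ j ∧ s < j ∧ j ≤ l ∧ x = (g ^ s) (G j k)} = ⊤ := by
  refine span_all g hg G hG _ ?_ ?_
  · intro x hx
    induction hx using Submodule.span_induction with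
    | mem x hx =>
      obtain ⟨s, j, k, h1, hs, hj, rfl⟩ := hx
      rw [← Module.End.mul_apply, ← pow_succ']
      rcases Nat.eq_or_lt_of_le (Nat.succ_le_of_lt hs) with h | h
      · have := hGK j h1 hj k
        rw [mem_kerPow] at this
        have h' : s + 1 = j := h
        rw [h', this]
        exact Submodule.zero_mem _
      · exact Submodule.subset_span ⟨s + 1, j, k, h1, h, hj, rfl⟩
    | zero => simp
    | add x y _ _ hx hy => rw [map_add]; exact Submodule.add_mem _ hx hy
    | smul a x _ hx => rw [map_smul]; exact Submodule.smul_mem _ _ hx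
  · intro j h1 hj k
    exact Submodule.subset_span ⟨0, j, k, h1, by omega, hj, by simp⟩

theorem exists_extension {l : ℕ} (hg : g ^ l = 0) {r : ℕ → ℕ} (F G : (j : ℕ) → Fin (r j) → M)
    (hF : ∀ j k, F j k ∈ kerPow g j)
    (hGK : ∀ j, 1 ≤ j → j ≤ l → ∀ k, G j k ∈ kerPow g j)
    (hspan : ∀ j, 1 ≤ j → j ≤ l →
      kerPow g j ≤ Submodule.span R (Set.range (F j)) ⊔ Lsub g j)
    (hind : ∀ j, 1 ≤ j → j ≤ l → ∀ c : Fin (r j) → R,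
      ∑ k, c k • F j k ∈ Lsub g j → c = 0) :
    ∃ α : M →ₗ[R] M, (∀ x, α (g x) = g (α x)) ∧
      ∀ j, 1 ≤ j → j ≤ l → ∀ k, α (F j k) = G j k := by
  have hsp := span_pows g hg F (fun j _ _ => hF j) hspan
  have hsurj : LinearMap.range (totalMap g l F) = ⊤ := by
    rw [eq_top_iff, ← hsp, Submodule.span_le]
    rintro _ ⟨s, j, k, h1, hs, hj, rfl⟩
    exact ⟨_, totalMap_single g F s j hs hj k⟩
  have hker : LinearMap.ker (totalMap g l F) ≤ LinearMap.ker (totalMap g l G) := by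
    intro c hc
    rw [LinearMap.mem_ker, totalMap, LinearMap.sum_apply] at *
    have := indep_all g F hF hind c l le_rfl hc
    refine Finset.sum_eq_zero fun h hh => ?_
    rw [layerMap_apply]
    refine Finset.sum_eq_zero fun j hj => ?_
    rw [Finset.mem_Ico] at hh hj
    simp [this h hh.1 (by omega) j hj.1 (by omega)]
  let e := (totalMap g l F).quotKerEquivOfSurjective (LinearMap.range_eq_top.1 hsurj)
  let α : M →ₗ[R] M :=
    ((LinearMap.ker (totalMap g l F)).liftQ (totalMap g l G) hker) ∘ₗ e.symm.toLinearMap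
  have hα : ∀ c, α (totalMap g l F c) = totalMap g l G c := by
    intro c
    have : e.symm (totalMap g l F c) = Submodule.Quotient.mk c := by
      rw [LinearEquiv.symm_apply_eq]
      rfl
    change ((LinearMap.ker (totalMap g l F)).liftQ (totalMap g l G) hker)
      (e.symm (totalMap g l F c)) = _
    rw [this]
    rfl
  have hpow : ∀ s j k, 1 ≤ j → j ≤ l → α ((g ^ s) (F j k)) = (g ^ s) (G j k) := by
    intro s j k h1 hj
    by_cases hs : s < j
    · rw [← totalMap_single g F s j hs hj k, hα, totalMap_single g G s j hs hj k]
    · have a1 := kerPow_mono g (not_lt.1 hs) (hF j k)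
      have a2 := kerPow_mono g (not_lt.1 hs) (hGK j h1 hj k)
      rw [mem_kerPow] at a1 a2
      rw [a1, a2, map_zero]
  refine ⟨α, ?_, fun j h1 hj k => by simpa using hpow 0 j k h1 hj⟩
  have : α ∘ₗ g = g ∘ₗ α := by
    refine LinearMap.ext_on hsp ?_
    rintro _ ⟨s, j, k, h1, hs, hj, rfl⟩
    change α (g ((g ^ s) (F j k))) = g (α ((g ^ s) (F j k)))
    rw [hpow s j k h1 hj,
      ← Module.End.mul_apply g (g ^ s), ← Module.End.mul_apply g (g ^ s), ← pow_succ',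
      hpow _ j k h1 hj]
  exact fun x => LinearMap.congr_fun this x

end Helpers

/-- Let `(M,g)` be a standard `P_l(𝓞)`-module with standard generating
data `F_j ⊆ K_j` (lifting free bases of the `Q_j`), and for each `f ∈ F_j` choose
`t_f ∈ L_j`. Then there is an automorphism `α` of `(M,g)` with `α(f) = f + t_f` for every
`f`, and `α` induces the identity on every quotient `Q_i`. -/
theorem exists_automorphism_shifting_generators
    {K : Type*} [Field K] [NumberField K]
    {M : Type*} [AddCommGroup M] [Module (𝓞 K) M]
    [Module.Free ℤ M] [Module.Finite ℤ M]
    (l : ℕ) (hl : 1 ≤ l) (g : M →ₗ[𝓞 K] M) (hg : g ^ l = 0)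
    (hstd : ∀ i, 1 ≤ i → i ≤ l → Module.Free (𝓞 K) (Qquot g i))
    (r : ℕ → ℕ) (F : (j : ℕ) → Fin (r j) → M)
    (hF : ∀ j k, F j k ∈ kerPow g j)
    (hbasis : ∀ j, 1 ≤ j → j ≤ l →
      LinearIndependent (𝓞 K) (fun k : Fin (r j) =>
        (Submodule.Quotient.mk (⟨F j k, hF j k⟩ : ↥(kerPow g j)) : Qquot g j)) ∧
      Submodule.span (𝓞 K) (Set.range (fun k : Fin (r j) =>
        (Submodule.Quotient.mk (⟨F j k, hF j k⟩ : ↥(kerPow g j)) : Qquot g j))) = ⊤)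
    (t : (j : ℕ) → Fin (r j) → M)
    (ht : ∀ j, 1 ≤ j → j ≤ l → ∀ k, t j k ∈ Lsub g j) :
    ∃ α : M ≃ₗ[𝓞 K] M,
      (∀ x, α (g x) = g (α x)) ∧
      (∀ j, 1 ≤ j → j ≤ l → ∀ k : Fin (r j), α (F j k) = F j k + t j k) ∧
      (∀ i, 1 ≤ i → i ≤ l → ∀ x ∈ kerPow g i, α x - x ∈ Lsub g i) := by
  have hspan : ∀ j, 1 ≤ j → j ≤ l →
      kerPow g j ≤ Submodule.span (𝓞 K) (Set.range (F j)) ⊔ Lsub g j := by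
    intro j h1 hj x hx
    have hx' : (Submodule.Quotient.mk (⟨x, hx⟩ : ↥(kerPow g j)) : Qquot g j) ∈
      Submodule.span (𝓞 K) (Set.range (fun k : Fin (r j) =>
        (Submodule.Quotient.mk (⟨F j k, hF j k⟩ : ↥(kerPow g j)) : Qquot g j))) := by
      rw [(hbasis j h1 hj).2]
      trivial
    obtain ⟨c, hc⟩ := (Submodule.mem_span_range_iff_exists_fun _).1 hx'
    have hc2 : (Submodule.Quotient.mk (∑ k, c k • (⟨F j k, hF j k⟩ : ↥(kerPow g j))) :
        Qquot g j) = Submodule.Quotient.mk (⟨x, hx⟩ : ↥(kerPow g j)) := by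
      rw [← hc]
      simp only [← Submodule.mkQ_apply, map_sum, map_smul]
    have hc3 := (Submodule.Quotient.eq _).1 hc2
    rw [Submodule.mem_comap] at hc3
    have hc4 : ∑ k, c k • F j k - x ∈ Lsub g j := by simpa using hc3
    rw [← sub_sub_cancel (∑ k, c k • F j k) x]
    refine Submodule.sub_mem _ (Submodule.mem_sup_left ?_) (Submodule.mem_sup_right hc4)
    exact Submodule.sum_mem _ fun k _ => Submodule.smul_mem _ _ (Submodule.subset_span ⟨k, rfl⟩)
  have hind : ∀ j, 1 ≤ j → j ≤ l → ∀ c : Fin (r j) → 𝓞 K,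
      ∑ k, c k • F j k ∈ Lsub g j → c = 0 := by
    intro j h1 hj c hc
    have := Fintype.linearIndependent_iff.1 (hbasis j h1 hj).1 c ?_
    · exact funext this
    · have hc2 : (Submodule.Quotient.mk (∑ k, c k • (⟨F j k, hF j k⟩ : ↥(kerPow g j))) :
          Qquot g j) = 0 := by
        rw [Submodule.Quotient.mk_eq_zero, Submodule.mem_comap]
        simpa using hc
      rw [← hc2]
      simp only [← Submodule.mkQ_apply, map_sum, map_smul]
  have hGK : ∀ j, 1 ≤ j → j ≤ l → ∀ k, F j k + t j k ∈ kerPow g j := fun j h1 hj k =>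
    Submodule.add_mem _ (hF j k) (Lsub_le_kerPow g (ht j h1 hj k))
  obtain ⟨α, hcomm, hα⟩ := exists_extension g hg F (fun j k => F j k + t j k) hF hGK hspan hind
  have hsurj : LinearMap.range α = ⊤ := by
    refine span_all g hg (fun j k => F j k + t j k) ?_ _ ?_ ?_
    · intro j h1 hj
      refine (hspan j h1 hj).trans (sup_le (Submodule.span_le.2 ?_) le_sup_right)
      rintro _ ⟨k, rfl⟩
      rw [← add_sub_cancel_right (F j k) (t j k)]
      exact Submodule.sub_mem _ (Submodule.mem_sup_left (Submodule.subset_span ⟨k, rfl⟩))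
        (Submodule.mem_sup_right (ht j h1 hj k))
    · rintro _ ⟨x, rfl⟩
      exact ⟨g x, hcomm x⟩
    · intro j h1 hj k
      exact ⟨F j k, hα j h1 hj k⟩
  have hfin : Module.Finite (𝓞 K) M := Module.Finite.of_restrictScalars_finite ℤ (𝓞 K) M
  have hbij : Function.Bijective α :=
    OrzechProperty.bijective_of_surjective_endomorphism α (LinearMap.range_eq_top.1 hsurj)
  have hpow : ∀ i x, x ∈ kerPow g i → α x ∈ kerPow g i := by
    intro i
    induction i with
    | zero =>
      intro x hx
      have : x = 0 := by simpa [mem_kerPow] using hx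
      rw [this, map_zero]
      exact Submodule.zero_mem _
    | succ i ih =>
      intro x hx
      rw [← apply_mem_kerPow_iff] at hx ⊢
      rw [← hcomm]
      exact ih _ hx
  have hQ : ∀ n i, i + n = l + 1 → 1 ≤ i → ∀ x ∈ kerPow g i, α x - x ∈ Lsub g i := by
    intro n
    induction n with
    | zero =>
      intro i hi h1 x hx
      refine Submodule.mem_sup_right ?_
      have : i - 1 = l := by omega
      rw [this, mem_kerPow, hg, LinearMap.zero_apply]
    | succ n ih =>
      intro i hi h1 x hx
      obtain ⟨a, ha, b, hb, rfl⟩ := Submodule.mem_sup.1 (hspan i h1 (by omega) hx)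
      obtain ⟨_, ⟨y, hy, rfl⟩, z, hz, rfl⟩ := Submodule.mem_sup.1 hb
      have e1 : α a - a ∈ Lsub g i := by
        clear hx
        induction ha using Submodule.span_induction with
        | mem x hx =>
          obtain ⟨k, rfl⟩ := hx
          rw [hα i h1 (by omega) k, add_sub_cancel_left]
          exact ht i h1 (by omega) k
        | zero => simp
        | add x y _ _ hx hy =>
          rw [map_add, add_sub_add_comm]
          exact Submodule.add_mem _ hx hy
        | smul c x _ hx =>
          rw [map_smul, ← smul_sub]
          exact Submodule.smul_mem _ _ hx
      have e2 : g (α y - y) ∈ Lsub g i :=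
        apply_mem_Lsub g h1 (ih (i + 1) (by omega) (by omega) y hy)
      have e3 : α z - z ∈ Lsub g i :=
        Submodule.mem_sup_right (Submodule.sub_mem _ (hpow _ z hz) hz)
      have : α (a + (g y + z)) - (a + (g y + z)) = (α a - a) + (g (α y - y) + (α z - z)) := by
        rw [map_add, map_add, hcomm, map_sub]
        abel
      rw [this]
      exact Submodule.add_mem _ e1 (Submodule.add_mem _ e2 e3)
  exact ⟨LinearEquiv.ofBijective α hbij, hcomm, hα,
    fun i h1 hi => hQ (l + 1 - i) i (by omega) h1⟩
end

section
/- Let (M,g) be an integral P_l(𝓞)-module and let S ⊆ M be a standard submodule of finite index (a g-invariant 𝓞-submodule of finite additive index in M such that Q_i(S) is a free 𝓞-module for every 1 ≤ i ≤ l). Then: (a) for each 1 ≤ i ≤ l, L_i(S) = L_i(M) ∩ S, and the map ρ_i : Q_i(S) → Q_i(M), a + L_i(S) ↦ a + L_i(M), is an injective 𝓞-module homomorphism whose image R_i(S) has finite index in Q_i(M); (b) writing h_i = [Q_i(M) : R_i(S)], the index of S in M is [M : S] = h_1 · h_2² · ⋯ · h_l^l = ∏_{k=1}^l h_k^k. 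-/
open NumberField

theorem core_index {A : Type*} [AddCommGroup A] (g : A →+ A) (k : ℕ → AddSubgroup A)
    (S : AddSubgroup A) (l : ℕ) (h0 : k 0 = ⊥)
    (hk : ∀ i x, x ∈ k (i + 1) ↔ g x ∈ k i) (hmono : ∀ i, k i ≤ k (i + 1))
    (hS : ∀ x ∈ S, g x ∈ S) (hl : k l = ⊤)
    (hL : ∀ i, i < l → ∀ x ∈ S, x ∈ (k (i + 2)).map g ⊔ k i →
      ∃ s ∈ S, s ∈ k (i + 2) ∧ x - g s ∈ k i) :
    S.index = ∏ j ∈ Finset.Icc 1 l,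
      ((S ⊓ k j) ⊔ ((k (j + 1)).map g ⊔ k (j - 1))).relIndex (k j) ^ j := by
  set h : ℕ → ℕ := fun j => ((S ⊓ k j) ⊔ ((k (j + 1)).map g ⊔ k (j - 1))).relIndex (k j) with hh
  let a : ℕ → ℕ := fun i => ((S ⊓ k (i + 1)) ⊔ k i).relIndex (k (i + 1))
  have hgk : ∀ i, (k (i + 1)).map g ≤ k i := by
    rintro i _ ⟨x, hx, rfl⟩
    exact (hk i x).1 hx
  have step1 : ∀ i, S.relIndex (k (i + 1)) = S.relIndex (k i) * a i := by
    intro i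
    have e1 : (S ⊓ k (i + 1)).relIndex ((S ⊓ k (i + 1)) ⊔ k i) = S.relIndex (k i) := by
      rw [AddSubgroup.relIndex_sup_left, ← AddSubgroup.inf_relIndex_right, inf_assoc,
        inf_eq_right.2 (hmono i), AddSubgroup.inf_relIndex_right]
    rw [← e1]
    have := AddSubgroup.relIndex_mul_relIndex (S ⊓ k (i + 1)) ((S ⊓ k (i + 1)) ⊔ k i) (k (i + 1))
      le_sup_left (sup_le inf_le_right (hmono i))
    rw [AddSubgroup.inf_relIndex_right] at this
    exact this.symm
  have step2 : ∀ i, i < l → a i = h (i + 1) * a (i + 1) := by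
    intro i hi
    have e0 : (S ⊓ k (i + 1)) ⊔ ((k (i + 2)).map g ⊔ k i)
        = ((S ⊓ k (i + 1)) ⊔ k i) ⊔ (k (i + 2)).map g := by
      rw [sup_assoc, sup_comm (k i)]
    have e1 : ((S ⊓ k (i + 1)) ⊔ k i).relIndex
        ((S ⊓ k (i + 1)) ⊔ ((k (i + 2)).map g ⊔ k i)) = a (i + 1) := by
      rw [e0, AddSubgroup.relIndex_sup_left, ← AddSubgroup.relIndex_comap,
        ← AddSubgroup.inf_relIndex_right]
      show _ = ((S ⊓ k (i + 2)) ⊔ k (i + 1)).relIndex (k (i + 2))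
      congr 1
      apply le_antisymm
      · rintro y ⟨hy1, hy2⟩
        obtain ⟨s, hs, z, hz, hsz⟩ := AddSubgroup.mem_sup.1 (AddSubgroup.mem_comap.1 hy1)
        obtain ⟨s', hs', hs'k, hd⟩ := hL i hi s hs.1 (by
          have : s = g y + -z := by rw [← hsz]; abel
          rw [this]
          exact AddSubgroup.add_mem_sup (AddSubgroup.mem_map_of_mem g hy2) (neg_mem hz))
        refine AddSubgroup.mem_sup.2 ⟨s', ⟨hs', hs'k⟩, y - s', ?_, by abel⟩
        rw [hk, map_sub]
        have : g y - g s' = (s - g s') + z := by rw [← hsz]; abel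
        rw [this]
        exact add_mem hd hz
      · refine le_inf (sup_le ?_ ?_) (sup_le inf_le_right (hmono _))
        · rintro y ⟨hy1, hy2⟩
          exact AddSubgroup.mem_sup_left ⟨hS y hy1, (hk _ y).1 hy2⟩
        · intro y hy
          exact AddSubgroup.mem_sup_right ((hk _ y).1 hy)
    have := AddSubgroup.relIndex_mul_relIndex ((S ⊓ k (i + 1)) ⊔ k i)
      ((S ⊓ k (i + 1)) ⊔ ((k (i + 2)).map g ⊔ k i)) (k (i + 1))
      (sup_le_sup_left le_sup_right _)
      (sup_le inf_le_right (sup_le (hgk _) (hmono i)))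
    rw [e1] at this
    rw [mul_comm]
    exact this.symm
  have main : ∀ n, n ≤ l → S.relIndex (k n) = (∏ j ∈ Finset.Icc 1 n, h j ^ j) * a n ^ n := by
    intro n
    induction n with
    | zero => intro _; simp [h0]
    | succ n ih =>
      intro hn
      rw [step1, ih (by omega), Finset.prod_Icc_succ_top (by omega), mul_assoc, ← pow_succ,
        step2 n (by omega), mul_pow, mul_assoc]
  have := main l le_rfl
  have hal : a l = 1 := by
    have : k (l + 1) = ⊤ := top_le_iff.1 (hl ▸ hmono l)
    simp [a, hl, this]
  rw [hal, hl] at this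
  simpa using this

theorem mem_kerPow_restrict {R M : Type*} [CommRing R] [AddCommGroup M] [Module R M]
    (g : M →ₗ[R] M) (S : Submodule R M) (hSg : ∀ x ∈ S, g x ∈ S) (i : ℕ) (x : S) :
    x ∈ kerPow (g.restrict hSg) i ↔ (x : M) ∈ kerPow g i := by
  have : ∀ (i : ℕ) (x : S), (((g.restrict hSg) ^ i) x : M) = (g ^ i) x := by
    intro i
    induction i with
    | zero => intro x; simp
    | succ n ih => intro x; simp [pow_succ, ih]
  simp only [kerPow, LinearMap.mem_ker, ← this]
  simp

theorem kerPow_succ_mem {R M : Type*} [CommRing R] [AddCommGroup M] [Module R M]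
    (g : M →ₗ[R] M) (i : ℕ) (x : M) : x ∈ kerPow g (i + 1) ↔ g x ∈ kerPow g i := by
  simp [kerPow, pow_succ]

theorem kerPow_mono_succ {R M : Type*} [CommRing R] [AddCommGroup M] [Module R M]
    (g : M →ₗ[R] M) (i : ℕ) : kerPow g i ≤ kerPow g (i + 1) := by
  intro x hx
  simp only [kerPow, LinearMap.mem_ker] at *
  simp [pow_succ', hx]

theorem Lsub_le {R M : Type*} [CommRing R] [AddCommGroup M] [Module R M]
    (g : M →ₗ[R] M) (i : ℕ) (hi : 1 ≤ i) : Lsub g i ≤ kerPow g i := by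
  refine sup_le ?_ ?_
  · rintro _ ⟨x, hx, rfl⟩
    exact (kerPow_succ_mem g i x).1 hx
  · obtain ⟨j, rfl⟩ := Nat.exists_eq_add_of_le' hi
    exact kerPow_mono_succ g j

theorem Lsub_restrict_le {R M : Type*} [CommRing R] [AddCommGroup M] [Module R M]
    (g : M →ₗ[R] M) (S : Submodule R M) (hSg : ∀ x ∈ S, g x ∈ S) (i : ℕ) (x : S)
    (hx : x ∈ Lsub (g.restrict hSg) i) : (x : M) ∈ Lsub g i := by
  obtain ⟨_, ⟨y, hy, rfl⟩, z, hz, rfl⟩ := Submodule.mem_sup.1 hx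
  exact Submodule.mem_sup.2 ⟨g y, ⟨y, (mem_kerPow_restrict g S hSg _ _).1 hy, rfl⟩, z,
    (mem_kerPow_restrict g S hSg _ _).1 hz, rfl⟩

theorem Lsub_restrict_nsmul {R M : Type*} [CommRing R] [AddCommGroup M] [Module R M]
    (g : M →ₗ[R] M) (S : Submodule R M) (hSg : ∀ x ∈ S, g x ∈ S) (i : ℕ) (x : S)
    (hx : (x : M) ∈ Lsub g i) (n : ℕ) (hn : ∀ y : M, n • y ∈ S) :
    n • x ∈ Lsub (g.restrict hSg) i := by
  obtain ⟨_, ⟨y, hy, rfl⟩, z, hz, hxe⟩ := Submodule.mem_sup.1 hx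
  refine Submodule.mem_sup.2 ⟨g.restrict hSg ⟨n • y, hn y⟩, ⟨⟨n • y, hn y⟩,
    (mem_kerPow_restrict g S hSg _ _).2 (Submodule.smul_of_tower_mem _ n hy), rfl⟩, ⟨n • z, hn z⟩,
    (mem_kerPow_restrict g S hSg _ _).2 (Submodule.smul_of_tower_mem _ n hz), ?_⟩
  ext
  simp [← hxe]

/-- Let `(M,g)` be an integral `P_l(𝓞)`-module and `S` a standard
submodule of finite index. Then (a) for each `1 ≤ i ≤ l`, `L_i(S) = L_i(M) ∩ S` and the
map `ρ_i : Q_i(S) → Q_i(M)`, `a + L_i(S) ↦ a + L_i(M)`, is an injective `𝓞`-homomorphism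
whose image has finite index `h_i` in `Q_i(M)`; and (b) `[M : S] = ∏_{k=1}^l h_k^k`. -/
theorem standard_submodule_index_formula
    {K : Type*} [Field K] [NumberField K]
    {M : Type*} [AddCommGroup M] [Module (𝓞 K) M]
    [Module.Free ℤ M] [Module.Finite ℤ M]
    (l : ℕ) (hl : 1 ≤ l) (g : M →ₗ[𝓞 K] M) (hg : g ^ l = 0)
    (S : Submodule (𝓞 K) M) (hSg : ∀ x ∈ S, g x ∈ S)
    (hSfin : S.toAddSubgroup.index ≠ 0)
    (hSstd : ∀ i, 1 ≤ i → i ≤ l → Module.Free (𝓞 K) (Qquot (g.restrict hSg) i)) :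
    ∃ h : ℕ → ℕ,
      (∀ i, 1 ≤ i → i ≤ l →
        (Lsub (g.restrict hSg) i).map S.subtype = Lsub g i ⊓ S ∧
        ∃ ρ : Qquot (g.restrict hSg) i →ₗ[𝓞 K] Qquot g i,
          (∀ (x : ↥(kerPow (g.restrict hSg) i)) (hx : ((x : ↥S) : M) ∈ kerPow g i),
              ρ (Submodule.Quotient.mk x) =
                Submodule.Quotient.mk ⟨((x : ↥S) : M), hx⟩) ∧
          Function.Injective ρ ∧
          (LinearMap.range ρ).toAddSubgroup.index = h i ∧ h i ≠ 0) ∧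
      S.toAddSubgroup.index = ∏ k ∈ Finset.Icc 1 l, h k ^ k := by
  have key : ∀ i, 1 ≤ i → i ≤ l → ∀ x : S, (x : M) ∈ Lsub g i →
      x ∈ Lsub (g.restrict hSg) i := by
    intro i h1 h2 x hx
    have hfree := hSstd i h1 h2
    have hxk : x ∈ kerPow (g.restrict hSg) i :=
      (mem_kerPow_restrict g S hSg i x).2 (Lsub_le g i h1 hx)
    have hn := Lsub_restrict_nsmul g S hSg i x hx S.toAddSubgroup.index
      (fun y => AddSubgroup.nsmul_index_mem S.toAddSubgroup y)
    set n := S.toAddSubgroup.index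
    let q : Qquot (g.restrict hSg) i := Submodule.Quotient.mk ⟨x, hxk⟩
    have hq : (n : 𝓞 K) • q = 0 := by
      rw [← Submodule.Quotient.mk_smul, Submodule.Quotient.mk_eq_zero]
      rw [Submodule.mem_comap]
      simpa [Nat.cast_smul_eq_nsmul] using hn
    have hq0 : q = 0 := (smul_eq_zero.1 hq).resolve_left (by exact_mod_cast hSfin)
    exact (Submodule.Quotient.mk_eq_zero ((Lsub (g.restrict hSg) i).comap
      (kerPow (g.restrict hSg) i).subtype)).1 hq0
  let kk : ℕ → AddSubgroup M := fun i => (kerPow g i).toAddSubgroup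
  refine ⟨fun j => ((S.toAddSubgroup ⊓ kk j) ⊔
    ((kk (j + 1)).map g.toAddMonoidHom ⊔ kk (j - 1))).relIndex (kk j), ?_, ?_⟩
  · intro i h1 h2
    refine ⟨?_, ?_⟩
    · ext x
      constructor
      · rintro ⟨y, hy, rfl⟩
        exact ⟨Lsub_restrict_le g S hSg i y hy, y.2⟩
      · rintro ⟨hx, hxS⟩
        exact ⟨⟨x, hxS⟩, key i h1 h2 ⟨x, hxS⟩ hx, rfl⟩
    · let f : ↥(kerPow (g.restrict hSg) i) →ₗ[𝓞 K] ↥(kerPow g i) :=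
        (S.subtype.comp (kerPow (g.restrict hSg) i).subtype).codRestrict (kerPow g i)
          (fun x => (mem_kerPow_restrict g S hSg i x).1 x.2)
      let ρ : Qquot (g.restrict hSg) i →ₗ[𝓞 K] Qquot g i :=
        Submodule.mapQ _ _ f (fun x hx => Lsub_restrict_le g S hSg i x hx)
      refine ⟨ρ, fun x hx => rfl, ?_, ?_, ?_⟩
      · rw [injective_iff_map_eq_zero]
        intro q
        obtain ⟨x, rfl⟩ := Submodule.Quotient.mk_surjective _ q
        intro hx
        have hx' : ((x : S) : M) ∈ Lsub g i :=
          (Submodule.Quotient.mk_eq_zero ((Lsub g i).comap (kerPow g i).subtype)).1 hx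
        exact (Submodule.Quotient.mk_eq_zero _).2 (key i h1 h2 x hx')
      · let π := ((Lsub g i).comap (kerPow g i).subtype).mkQ
        have hπ : Function.Surjective π.toAddMonoidHom := Submodule.mkQ_surjective _
        rw [← AddSubgroup.index_comap_of_surjective _ hπ]
        have hLe : (kk (i + 1)).map g.toAddMonoidHom ⊔ kk (i - 1) = (Lsub g i).toAddSubgroup := by
          rw [Lsub, Submodule.sup_toAddSubgroup]
          rfl
        beta_reduce
        rw [hLe, AddSubgroup.relIndex]
        congr 1
        ext ⟨x, hx⟩
        rw [AddSubgroup.mem_addSubgroupOf, AddSubgroup.mem_sup]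
        constructor
        · rintro ⟨q, hq⟩
          obtain ⟨y, rfl⟩ := Submodule.Quotient.mk_surjective _ q
          have hq' : (Submodule.Quotient.mk (f y) : Qquot g i) = Submodule.Quotient.mk ⟨x, hx⟩ := hq
          have h3 := (Submodule.Quotient.eq _).1 hq'.symm
          exact ⟨_, ⟨y.1.2, (f y).2⟩, _, h3, add_sub_cancel ((y : S) : M) x⟩
        · rintro ⟨s, hs, z, hz, hsz⟩
          refine ⟨Submodule.Quotient.mk ⟨⟨s, hs.1⟩, (mem_kerPow_restrict g S hSg i _).2 hs.2⟩, ?_⟩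
          show (Submodule.Quotient.mk (f _) : Qquot g i) = Submodule.Quotient.mk ⟨x, hx⟩
          symm
          rw [Submodule.Quotient.eq]
          show x - s ∈ Lsub g i
          have : x - s = z := by rw [← show s + z = x from hsz]; abel
          rw [this]
          exact hz
      · have hd : S.toAddSubgroup.relIndex (kk i) ≠ 0 := fun h0 =>
          hSfin (Nat.eq_zero_of_zero_dvd (h0 ▸ AddSubgroup.relIndex_dvd_index_of_normal _ _))
        rw [← AddSubgroup.inf_relIndex_right] at hd
        intro h0
        exact hd (Nat.eq_zero_of_zero_dvd (h0 ▸ AddSubgroup.relIndex_dvd_of_le_left _ le_sup_left))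
  · refine core_index g.toAddMonoidHom kk S.toAddSubgroup l ?_ (kerPow_succ_mem g)
      (kerPow_mono_succ g) hSg ?_ ?_
    · ext x; simp [kk, kerPow]
    · ext x; simp [kk, kerPow, hg]
    · intro i hi x hxS hx
      have hLe : (kk (i + 2)).map g.toAddMonoidHom ⊔ kk i = (Lsub g (i + 1)).toAddSubgroup := by
        rw [Lsub, Submodule.sup_toAddSubgroup]
        rfl
      rw [hLe] at hx
      obtain ⟨_, ⟨y, hy, rfl⟩, z, hz, hxe⟩ :=
        Submodule.mem_sup.1 (key (i + 1) (by omega) (by omega) ⟨x, hxS⟩ hx)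
      refine ⟨y, y.2, (mem_kerPow_restrict g S hSg _ _).1 hy, ?_⟩
      have h4 : g y + z = x := congrArg Subtype.val hxe
      have : x - g y = z := by rw [← h4]; abel
      show x - g y ∈ kerPow g i
      rw [this]
      exact (mem_kerPow_restrict g S hSg _ _).1 hz
end
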